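/- arXiv:2011.06586 — 5 statements merged into one kernel-verified Lean document; each statement's English description precedes it below -/
import Mathlib

section
/- For every ε > 0 there exists a constant C_ε > 0 such that N(T) ≤ C_ε * T^(1/2 + ε) for all T ≥ 2. -/
open Real

/-- The conditions defining the tuples counted by `N(T)`. -/
def StackyCounted (T : ℝ) (x1 x2 x3 y1 y2 y3 : ℤ) : Prop :=
  x1 ≠ 0 ∧ x2 ≠ 0 ∧ x3 ≠ 0 ∧ y1 ≠ 0 ∧ y2 ≠ 0 ∧ y3 ≠ 0 ∧
  Int.gcd x1 x2 = 1 ∧ Int.gcd x1 x3 = 1 ∧ Int.gcd x2 x3 = 1 ∧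
  Int.gcd y1 y2 = 1 ∧ Int.gcd y1 y3 = 1 ∧ Int.gcd y2 y3 = 1 ∧
  Squarefree x1 ∧ Squarefree x2 ∧ Squarefree x3 ∧
  x1 * y1 ^ 2 + x2 * y2 ^ 2 = x3 * y3 ^ 2 ∧
  0 < x1 ∧ |x2 * y2 ^ 2| ≤ x1 * y1 ^ 2 ∧
  ((|(x1 * y1) ^ 2 * x2 * x3| : ℤ) : ℝ) ≤ T

/-- `N(T)`: the number of tuples satisfying the height bound `T`. -/
noncomputable def stackyN (T : ℝ) : ℕ :=
  Set.ncard {v : ℤ × ℤ × ℤ × ℤ × ℤ × ℤ |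
    StackyCounted T v.1 v.2.1 v.2.2.1 v.2.2.2.1 v.2.2.2.2.1 v.2.2.2.2.2}

lemma dvd_two_mul_det {a b c p q y₁ y₂ z₁ z₂ : ℤ} (hac : IsCoprime a c)
    (hq : IsCoprime q c) (hy₁ : IsCoprime y₁ c)
    (hp : c ^ 2 ∣ a * p ^ 2 + b * q ^ 2) (hy : c ^ 2 ∣ a * y₁ ^ 2 + b * y₂ ^ 2)
    (hz : c ^ 2 ∣ a * z₁ ^ 2 + b * z₂ ^ 2)
    (hg : Int.gcd (y₁ * q - p * y₂) (c ^ 2) = Int.gcd (z₁ * q - p * z₂) (c ^ 2)) (hc : c ≠ 0) :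
    c ^ 2 ∣ 2 * (y₁ * z₂ - z₁ * y₂) := by
  have split : ∀ u v : ℤ, c ^ 2 ∣ a * u ^ 2 + b * v ^ 2 →
      c ^ 2 ∣ (u * q - p * v) * (u * q + p * v) := by
    intro u v h
    have h1 : c ^ 2 ∣ a * ((u * q - p * v) * (u * q + p * v)) := by
      rw [show a * ((u * q - p * v) * (u * q + p * v)) =
        q ^ 2 * (a * u ^ 2 + b * v ^ 2) - v ^ 2 * (a * p ^ 2 + b * q ^ 2) by ring]
      exact (h.mul_left (q ^ 2)).sub (hp.mul_left (v ^ 2))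
    exact (hac.symm.pow_left).dvd_of_dvd_mul_left h1
  obtain ⟨g, hgdef⟩ : ∃ g : ℤ, g = Int.gcd (y₁ * q - p * y₂) (c ^ 2) := ⟨_, rfl⟩
  have hgc : g ∣ c ^ 2 := hgdef ▸ Int.gcd_dvd_right _ _
  have hgy : g ∣ y₁ * q - p * y₂ := hgdef ▸ Int.gcd_dvd_left _ _
  have hgz : g ∣ z₁ * q - p * z₂ := by rw [hgdef, hg]; exact Int.gcd_dvd_left _ _
  obtain ⟨h, hh⟩ := hgc
  have hg0 : g ≠ 0 := by
    rintro rfl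
    simp [hc] at hh
  have cofactor : ∀ u v : ℤ, c ^ 2 ∣ a * u ^ 2 + b * v ^ 2 →
      g = Int.gcd (u * q - p * v) (c ^ 2) → h ∣ u * q + p * v := by
    intro u v huv hguv
    obtain ⟨m, hm⟩ : g ∣ u * q - p * v := hguv ▸ Int.gcd_dvd_left _ _
    have h1 := split u v huv
    rw [hh, hm, mul_assoc] at h1
    have h2 : h ∣ m * (u * q + p * v) := (mul_dvd_mul_iff_left hg0).1 h1
    have h3 : IsCoprime h m := by
      rw [hh, hm, Int.gcd_mul_left] at hguv
      have h4 : g.natAbs = g.natAbs * Int.gcd m h := by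
        have h5 := congrArg Int.natAbs hguv
        rwa [Int.natAbs_natCast] at h5
      have h5 : Int.gcd m h = 1 := by
        have : 0 < g.natAbs := Int.natAbs_pos.2 hg0
        exact Nat.eq_of_mul_eq_mul_left this (by rw [← h4, mul_one])
      exact (Int.isCoprime_iff_gcd_eq_one.2 h5).symm
    exact h3.dvd_of_dvd_mul_left h2
  have hhy := cofactor y₁ y₂ hy hgdef
  have hhz := cofactor z₁ z₂ hz (by rw [hgdef, hg])
  have hgco : ∀ w : ℤ, IsCoprime w c → IsCoprime g w ∧ IsCoprime h w := by
    intro w hw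
    have : IsCoprime (g * h) w := hh ▸ hw.symm.pow_left
    exact ⟨this.of_mul_left_left, this.of_mul_left_right⟩
  have hgD : g ∣ y₁ * z₂ - z₁ * y₂ := by
    refine (hgco q hq).1.dvd_of_dvd_mul_left ?_
    rw [show q * (y₁ * z₂ - z₁ * y₂) =
      z₂ * (y₁ * q - p * y₂) - y₂ * (z₁ * q - p * z₂) by ring]
    exact (hgy.mul_left z₂).sub (hgz.mul_left y₂)
  have hhD : h ∣ y₁ * z₂ - z₁ * y₂ := by
    refine (hgco q hq).2.dvd_of_dvd_mul_left ?_
    rw [show q * (y₁ * z₂ - z₁ * y₂) =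
      z₂ * (y₁ * q + p * y₂) - y₂ * (z₁ * q + p * z₂) by ring]
    exact (hhy.mul_left z₂).sub (hhz.mul_left y₂)
  have hd2 : (Int.gcd g h : ℤ) ∣ 2 := by
    have h1 : (Int.gcd g h : ℤ) ∣ (2 * y₁) * q := by
      rw [show 2 * y₁ * q = (y₁ * q - p * y₂) + (y₁ * q + p * y₂) by ring]
      exact ((Int.gcd_dvd_left g h).trans hgy).add ((Int.gcd_dvd_right g h).trans hhy)
    have h2 := ((hgco q hq).1.of_isCoprime_of_dvd_left (Int.gcd_dvd_left g h)).dvd_of_dvd_mul_right h1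
    exact ((hgco y₁ hy₁).1.of_isCoprime_of_dvd_left (Int.gcd_dvd_left g h)).dvd_of_dvd_mul_right h2
  have hl : (Int.lcm g h : ℤ) ∣ y₁ * z₂ - z₁ * y₂ := Int.coe_lcm_dvd hgD hhD
  have := mul_dvd_mul hd2 hl
  rw [← Nat.cast_mul, Int.gcd_mul_lcm, ← Int.natAbs_mul, ← hh, Int.natAbs_dvd] at this
  exact this

lemma card_divisors_le_rpow (ε : ℝ) (hε : 0 < ε) :
    ∃ C : ℝ, 0 < C ∧ ∀ n : ℕ, n ≠ 0 → (n.divisors.card : ℝ) ≤ C * (n : ℝ) ^ ε := by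
  obtain ⟨P, hP⟩ := exists_nat_ge ((2 : ℝ) ^ (1 / ε))
  obtain ⟨D, hD1, hD⟩ : ∃ D : ℝ, 1 ≤ D ∧ ∀ e : ℕ, (e + 1 : ℝ) ≤ D * (2 : ℝ) ^ (e * ε) := by
    refine ⟨1 + 1 / (ε * Real.log 2), ?_, fun e => ?_⟩
    · have := Real.log_pos one_lt_two
      have : 0 < 1 / (ε * Real.log 2) := by positivity
      linarith
    · have hl := Real.log_pos one_lt_two
      have h1 : e * ε * Real.log 2 + 1 ≤ (2 : ℝ) ^ (e * ε) := by
        rw [Real.rpow_def_of_pos two_pos]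
        have := Real.add_one_le_exp (Real.log 2 * (e * ε))
        linarith
      have h0 : (0 : ℝ) ≤ e * ε * Real.log 2 := by positivity
      have h2 : (e : ℝ) = 1 / (ε * Real.log 2) * (e * ε * Real.log 2) := by
        field_simp
      have h3 : 0 < 1 / (ε * Real.log 2) := by positivity
      have : (e : ℝ) ≤ 1 / (ε * Real.log 2) * (2 : ℝ) ^ (e * ε) := by
        rw [h2]
        gcongr
        rw [← h2]
        linarith
      nlinarith
  refine ⟨D ^ P, by positivity, fun n hn => ?_⟩
  have hloc : ∀ p ∈ n.primeFactors, ((n.factorization p : ℝ) + 1) ≤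
      (if p < P then D else 1) * ((p : ℝ) ^ n.factorization p) ^ ε := by
    intro p hp
    have hp2 : (2 : ℝ) ≤ p := by exact_mod_cast (Nat.prime_of_mem_primeFactors hp).two_le
    have hpow : ((p : ℝ) ^ n.factorization p) ^ ε = (p : ℝ) ^ (n.factorization p * ε) := by
      rw [← Real.rpow_natCast, ← Real.rpow_mul (by positivity)]
    split_ifs with h
    · refine (hD _).trans ?_
      rw [hpow]
      gcongr
    · have h1 : (2 : ℝ) ≤ (p : ℝ) ^ ε := by
        have : (2 : ℝ) ^ (1 / ε) ≤ p := hP.trans (by exact_mod_cast not_lt.1 h)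
        have := Real.rpow_le_rpow (by positivity) this hε.le
        rwa [← Real.rpow_mul (by positivity), one_div_mul_cancel hε.ne', Real.rpow_one] at this
      rw [hpow, one_mul, mul_comm, Real.rpow_mul (by positivity), Real.rpow_natCast]
      calc ((n.factorization p : ℝ) + 1) ≤ (2 : ℝ) ^ n.factorization p := by
            exact_mod_cast Nat.lt_two_pow_self
        _ ≤ _ := by gcongr
  have hn' : (n : ℝ) = ∏ p ∈ n.primeFactors, (p : ℝ) ^ n.factorization p := by
    conv_lhs => rw [← Nat.prod_factorization_pow_eq_self hn]
    simp [Finsupp.prod]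
  calc (n.divisors.card : ℝ) = ∏ p ∈ n.primeFactors, ((n.factorization p : ℝ) + 1) := by
        rw [Nat.card_divisors hn]
        push_cast
        rfl
    _ ≤ ∏ p ∈ n.primeFactors,
        ((if p < P then D else 1) * ((p : ℝ) ^ n.factorization p) ^ ε) :=
        Finset.prod_le_prod (fun _ _ => by positivity) hloc
    _ = (∏ p ∈ n.primeFactors, if p < P then D else 1) * (n : ℝ) ^ ε := by
        rw [Finset.prod_mul_distrib, Real.finsetProd_rpow _ _ (fun _ _ => by positivity), ← hn']
    _ ≤ D ^ P * (n : ℝ) ^ ε := by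
        gcongr
        rw [← Finset.prod_filter, Finset.prod_const]
        refine pow_le_pow_right₀ hD1 ?_
        calc _ ≤ (Finset.range P).card := Finset.card_le_card fun p hp => by
              simpa using (Finset.mem_filter.1 hp).2
          _ = P := Finset.card_range P

lemma two_mul_abs_det_lt {α β δ u v u' v' B : ℝ} (hα : 0 < α) (hβ : 0 < β) (hu : 0 < u)
    (hv : 0 < v) (hu' : 0 < u') (hv' : 0 < v') (hB : α * u + β * v ≤ B)
    (hB' : α * u' + β * v' ≤ B)
    (h : |(α * u - β * v) / (α * u + β * v) - (α * u' - β * v') / (α * u' + β * v')| < δ) :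
    2 * (α * β) * |u * v' - u' * v| < B ^ 2 * δ := by
  have hw : 0 < α * u + β * v := by positivity
  have hw' : 0 < α * u' + β * v' := by positivity
  have key : 2 * (α * β) * (u * v' - u' * v) = ((α * u + β * v) * (α * u' + β * v')) *
      ((α * u - β * v) / (α * u + β * v) - (α * u' - β * v') / (α * u' + β * v')) := by
    field_simp
    ring
  have key' := congrArg abs key
  rw [abs_mul, abs_mul (_ * _) (_ - _), abs_of_pos (by positivity : 0 < 2 * (α * β)),
    abs_of_pos (mul_pos hw hw')] at key'
  rw [key']
  have hB0 : 0 < B := hw.trans_le hB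
  calc _ < (α * u + β * v) * (α * u' + β * v') * δ := by gcongr
    _ ≤ B * B * δ := by
      have : 0 < δ := (abs_nonneg _).trans_lt h
      gcongr
    _ = B ^ 2 * δ := by ring

lemma eq_of_det_eq_zero {y₁ y₂ z₁ z₂ : ℤ} (hy₁ : 0 < y₁) (hz₁ : 0 < z₁)
    (hy : IsCoprime y₁ y₂) (hz : IsCoprime z₁ z₂) (h : y₁ * z₂ - z₁ * y₂ = 0) :
    y₁ = z₁ ∧ y₂ = z₂ := by
  have h1 : y₁ ∣ z₁ := hy.dvd_of_dvd_mul_right ⟨z₂, by linarith⟩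
  have h2 : z₁ ∣ y₁ := hz.dvd_of_dvd_mul_right ⟨y₂, by linarith⟩
  have h3 : y₁ = z₁ := Int.dvd_antisymm hy₁.le hz₁.le h1 h2
  subst h3
  refine ⟨rfl, ?_⟩
  have : y₁ * (z₂ - y₂) = 0 := by linarith
  rcases mul_eq_zero.1 this with h | h <;> omega

lemma abs_sub_div_add_le {α β u v B M : ℝ} (hB : 0 < B)
    (hw : B ≤ α * u + β * v) (hM : |(α * u) ^ 2 - (β * v) ^ 2| ≤ M) :
    |(α * u - β * v) / (α * u + β * v)| ≤ M / B ^ 2 := by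
  have hw0 := hB.trans_le hw
  have h1 : (α * u - β * v) / (α * u + β * v) =
      ((α * u) ^ 2 - (β * v) ^ 2) / (α * u + β * v) ^ 2 := by
    field_simp
    ring
  rw [h1, abs_div, abs_of_pos (by positivity : 0 < (α * u + β * v) ^ 2)]
  have : 0 ≤ M := (abs_nonneg _).trans hM
  gcongr

lemma card_fiber_le {a b c : ℤ} (ha : a ≠ 0) (hb : b ≠ 0) (hc : c ≠ 0) (hac : IsCoprime a c)
    (W : ℕ) {M : ℝ} (hM0 : 0 ≤ M) (F : Finset (ℤ × ℤ))
    (hF : ∀ y ∈ F, y.1 ≠ 0 ∧ y.2 ≠ 0 ∧ IsCoprime y.1 y.2 ∧ IsCoprime y.1 c ∧ IsCoprime y.2 c ∧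
      c ^ 2 ∣ a * y.1 ^ 2 + b * y.2 ^ 2 ∧ |(a * y.1 ^ 2 + b * y.2 ^ 2 : ℝ)| ≤ M ∧
      √|(a : ℝ)| * |(y.1 : ℝ)| + √|(b : ℝ)| * |(y.2 : ℝ)| < 2 ^ W) :
    (F.card : ℝ) ≤ 4 * (c.natAbs ^ 2).divisors.card * W *
      (2 * (4 * M / (√|(a : ℝ)| * √|(b : ℝ)| * (c : ℝ) ^ 2)) + 2) := by
  rcases F.eq_empty_or_nonempty with rfl | ⟨⟨p₀, q₀⟩, hbase⟩
  · simp only [Finset.card_empty, Nat.cast_zero]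
    positivity
  set α := √|(a : ℝ)| with hα
  set β := √|(b : ℝ)| with hβ
  have hca : (1 : ℝ) ≤ |(a : ℝ)| := by exact_mod_cast Int.one_le_abs ha
  have hcb : (1 : ℝ) ≤ |(b : ℝ)| := by exact_mod_cast Int.one_le_abs hb
  have hα1 : 1 ≤ α := Real.one_le_sqrt.2 hca
  have hβ1 : 1 ≤ β := Real.one_le_sqrt.2 hcb
  have hc2 : (0 : ℝ) < (c : ℝ) ^ 2 := by positivity
  set K := 4 * M / (α * β * (c : ℝ) ^ 2) with hK
  have hK0 : 0 ≤ K := by positivity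
  let w : ℤ × ℤ → ℝ := fun y => α * |(y.1 : ℝ)| + β * |(y.2 : ℝ)|
  let r : ℤ × ℤ → ℝ := fun y => (α * |(y.1 : ℝ)| - β * |(y.2 : ℝ)|) / w y
  let j : ℤ × ℤ → ℕ := fun y => Nat.log 2 ⌊w y⌋₊
  let δ : ℕ → ℝ := fun i => α * β * (c : ℝ) ^ 2 / (2 ^ (i + 1)) ^ 2
  have hδ : ∀ i, 0 < δ i := fun i => by positivity
  let key : ℤ × ℤ → ((ℤ × ℤ) × ℕ) × (ℕ × ℤ) := fun y =>
    (((y.1.sign, y.2.sign), Int.gcd (|y.1| * |q₀| - |p₀| * |y.2|) (c ^ 2)),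
      (j y, ⌊r y / δ (j y)⌋))
  have habs1 : ∀ n : ℤ, n ≠ 0 → (1 : ℝ) ≤ |(n : ℝ)| := fun n hn => by
    exact_mod_cast Int.one_le_abs hn
  have hw1 : ∀ y ∈ F, 1 ≤ w y := by
    intro y hy
    have h1 := habs1 _ (hF y hy).1
    have h2 := habs1 _ (hF y hy).2.1
    simp only [w]
    nlinarith
  have hjlow : ∀ y ∈ F, (2 : ℝ) ^ j y ≤ w y := by
    intro y hy
    have h1 : ⌊w y⌋₊ ≠ 0 := (Nat.floor_pos.2 (hw1 y hy)).ne'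
    have h2 := Nat.pow_log_le_self 2 h1
    have h3 := Nat.floor_le (zero_le_one.trans (hw1 y hy))
    calc (2 : ℝ) ^ j y ≤ (⌊w y⌋₊ : ℝ) := by exact_mod_cast h2
      _ ≤ _ := h3
  have hjup : ∀ y ∈ F, w y < (2 : ℝ) ^ (j y + 1) := by
    intro y hy
    have h1 : ⌊w y⌋₊ < 2 ^ (j y + 1) := Nat.lt_pow_succ_log_self one_lt_two _
    exact_mod_cast (Nat.floor_lt (zero_le_one.trans (hw1 y hy))).1 h1
  have hsq : ∀ n : ℤ, |n| ^ 2 = n ^ 2 := fun n => sq_abs n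
  have hmaps : ∀ y ∈ F, key y ∈ ((({1, -1} : Finset ℤ) ×ˢ ({1, -1} : Finset ℤ)) ×ˢ
      (c.natAbs ^ 2).divisors) ×ˢ (Finset.range W ×ˢ Finset.Icc ⌊-K⌋ ⌊K⌋) := by
    intro y hy
    obtain ⟨h1, h2, h3, h4, h5, h6, h7, h8⟩ := hF y hy
    have hsign : ∀ n : ℤ, n ≠ 0 → n.sign ∈ ({1, -1} : Finset ℤ) := by
      intro n hn
      rcases lt_or_gt_of_ne hn with h | h
      · simp [Int.sign_eq_neg_one_of_neg h]
      · simp [Int.sign_eq_one_of_pos h]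
    have hr : |r y / δ (j y)| ≤ K := by
      have hM' : |(α * |(y.1 : ℝ)|) ^ 2 - (β * |(y.2 : ℝ)|) ^ 2| ≤ M := by
        rw [mul_pow, mul_pow, hα, hβ, Real.sq_sqrt (abs_nonneg _), Real.sq_sqrt (abs_nonneg _),
          ← abs_pow, ← abs_pow, ← abs_mul, ← abs_mul]
        refine le_trans ?_ h7
        have := abs_abs_sub_abs_le ((a : ℝ) * (y.1 : ℝ) ^ 2) (-((b : ℝ) * (y.2 : ℝ) ^ 2))
        rwa [abs_neg, sub_neg_eq_add] at this
      have h9 := abs_sub_div_add_le (by positivity) (hjlow y hy) hM'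
      rw [abs_div, abs_of_pos (hδ _), div_le_iff₀ (hδ _)]
      refine h9.trans (le_of_eq ?_)
      simp only [hK, δ]
      field_simp
      ring
    rw [abs_le] at hr
    simp only [key, Finset.mem_product, Finset.mem_range, Finset.mem_Icc]
    refine ⟨⟨⟨hsign _ h1, hsign _ h2⟩, ?_⟩, ?_, Int.floor_le_floor hr.1, Int.floor_le_floor hr.2⟩
    · rw [Nat.mem_divisors]
      refine ⟨?_, by simpa using hc⟩
      rw [← Int.natAbs_pow]
      exact Int.gcd_dvd_natAbs_right _ _
    · exact (pow_lt_pow_iff_right₀ (one_lt_two : (1 : ℝ) < 2)).1 ((hjlow y hy).trans_lt h8)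
  have hinj : Set.InjOn key F := by
    intro y hy z hz hyz
    obtain ⟨h1, h2, h3, h4, h5, h6, h7, h8⟩ := hF y hy
    obtain ⟨k1, k2, k3, k4, k5, k6, k7, k8⟩ := hF z hz
    obtain ⟨l1, l2, l3, l4, l5, l6, l7, l8⟩ := hF _ hbase
    simp only [key, Prod.mk.injEq] at hyz
    obtain ⟨⟨⟨e1, e2⟩, e3⟩, e4, e5⟩ := hyz
    have hdvd := dvd_two_mul_det (a := a) (b := b) (p := |p₀|) (q := |q₀|) (y₁ := |y.1|)
      (y₂ := |y.2|) (z₁ := |z.1|) (z₂ := |z.2|) hac l5.abs_left h4.abs_left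
      (by simpa only [hsq] using l6) (by simpa only [hsq] using h6)
      (by simpa only [hsq] using k6) e3 hc
    rw [← e4] at e5
    have hfl := Int.abs_sub_lt_one_of_floor_eq_floor e5
    rw [← sub_div, abs_div, abs_of_pos (hδ _), div_lt_one (hδ _)] at hfl
    have p1 : 0 < |(y.1 : ℝ)| := zero_lt_one.trans_le (habs1 _ h1)
    have p2 : 0 < |(y.2 : ℝ)| := zero_lt_one.trans_le (habs1 _ h2)
    have p3 : 0 < |(z.1 : ℝ)| := zero_lt_one.trans_le (habs1 _ k1)
    have p4 : 0 < |(z.2 : ℝ)| := zero_lt_one.trans_le (habs1 _ k2)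
    have hlt := two_mul_abs_det_lt (by linarith) (by linarith) p1 p2 p3 p4 (hjup y hy).le
      (e4 ▸ (hjup z hz).le) hfl
    have hval : ((2 : ℝ) ^ (j y + 1)) ^ 2 * δ (j y) = α * β * (c : ℝ) ^ 2 := by
      simp only [δ]
      field_simp
    rw [hval, mul_comm 2, mul_assoc, mul_lt_mul_iff_right₀ (by positivity)] at hlt
    have hlt' : |2 * (|y.1| * |z.2| - |z.1| * |y.2|)| < c ^ 2 := by
      rw [abs_mul, abs_two]
      exact_mod_cast hlt
    have hzero := Int.eq_zero_of_abs_lt_dvd hdvd hlt'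
    obtain ⟨f1, f2⟩ := eq_of_det_eq_zero (abs_pos.2 h1) (abs_pos.2 k1) h3.abs_abs
      k3.abs_abs (by omega)
    refine Prod.ext ?_ ?_
    · rw [← Int.sign_mul_abs y.1, ← Int.sign_mul_abs z.1, e1, f1]
    · rw [← Int.sign_mul_abs y.2, ← Int.sign_mul_abs z.2, e2, f2]
  have hcard := Finset.card_le_card_of_injOn key hmaps hinj
  rw [Finset.card_product, Finset.card_product, Finset.card_product, Finset.card_product,
    Finset.card_range, Int.card_Icc] at hcard
  have h22 : ({1, -1} : Finset ℤ).card = 2 := by decide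
  rw [h22] at hcard
  have hfloor : (((⌊K⌋ + 1 - ⌊-K⌋).toNat : ℕ) : ℝ) ≤ 2 * K + 2 := by
    have h1 : (0 : ℤ) ≤ ⌊K⌋ + 1 - ⌊-K⌋ := by
      have := Int.floor_le_floor (neg_le_self hK0)
      omega
    have h2 : (((⌊K⌋ + 1 - ⌊-K⌋).toNat : ℕ) : ℝ) = ((⌊K⌋ + 1 - ⌊-K⌋ : ℤ) : ℝ) := by
      exact_mod_cast Int.toNat_of_nonneg h1
    rw [h2]
    push_cast
    have := Int.floor_le K
    have := Int.lt_floor_add_one (-K)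
    linarith
  calc (F.card : ℝ) ≤ ((2 * 2 * (c.natAbs ^ 2).divisors.card *
        (W * (⌊K⌋ + 1 - ⌊-K⌋).toNat) : ℕ) : ℝ) := by exact_mod_cast hcard
    _ = 4 * (c.natAbs ^ 2).divisors.card * W * (((⌊K⌋ + 1 - ⌊-K⌋).toNat : ℕ) : ℝ) := by
      push_cast
      ring
    _ ≤ _ := by gcongr

/-- The symmetric form of the counting conditions: the equation is homogenised to
`x₁ y₁² + x₂ y₂² + x₃ y₃² = 0` and the height is bounded through each of the three terms. -/
def SymCounted (U : ℝ) (x₁ x₂ x₃ y₁ y₂ y₃ : ℤ) : Prop :=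
  (x₁ ≠ 0 ∧ x₂ ≠ 0 ∧ x₃ ≠ 0) ∧ (y₁ ≠ 0 ∧ y₂ ≠ 0 ∧ y₃ ≠ 0) ∧
  (IsCoprime x₁ x₂ ∧ IsCoprime x₁ x₃ ∧ IsCoprime x₂ x₃) ∧
  (IsCoprime y₁ y₂ ∧ IsCoprime y₁ y₃ ∧ IsCoprime y₂ y₃) ∧
  x₁ * y₁ ^ 2 + x₂ * y₂ ^ 2 + x₃ * y₃ ^ 2 = 0 ∧
  |(x₁ : ℝ)| * (y₁ : ℝ) ^ 2 * (|(x₁ : ℝ)| * |(x₂ : ℝ)| * |(x₃ : ℝ)|) ≤ U ∧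
  |(x₂ : ℝ)| * (y₂ : ℝ) ^ 2 * (|(x₁ : ℝ)| * |(x₂ : ℝ)| * |(x₃ : ℝ)|) ≤ U ∧
  |(x₃ : ℝ)| * (y₃ : ℝ) ^ 2 * (|(x₁ : ℝ)| * |(x₂ : ℝ)| * |(x₃ : ℝ)|) ≤ U

namespace SymCounted

variable {U : ℝ} {x₁ x₂ x₃ y₁ y₂ y₃ : ℤ}

lemma swap_one_three (h : SymCounted U x₁ x₂ x₃ y₁ y₂ y₃) :
    SymCounted U x₃ x₂ x₁ y₃ y₂ y₁ := by
  obtain ⟨⟨a1, a2, a3⟩, ⟨b1, b2, b3⟩, ⟨c1, c2, c3⟩, ⟨d1, d2, d3⟩, e, h1, h2, h3⟩ := h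
  exact ⟨⟨a3, a2, a1⟩, ⟨b3, b2, b1⟩, ⟨c3.symm, c2.symm, c1.symm⟩, ⟨d3.symm, d2.symm, d1.symm⟩,
    by linarith, by linarith, by linarith, by linarith⟩

lemma swap_two_three (h : SymCounted U x₁ x₂ x₃ y₁ y₂ y₃) :
    SymCounted U x₁ x₃ x₂ y₁ y₃ y₂ := by
  obtain ⟨⟨a1, a2, a3⟩, ⟨b1, b2, b3⟩, ⟨c1, c2, c3⟩, ⟨d1, d2, d3⟩, e, h1, h2, h3⟩ := h
  exact ⟨⟨a1, a3, a2⟩, ⟨b1, b3, b2⟩, ⟨c2, c1, c3.symm⟩, ⟨d2, d1, d3.symm⟩,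
    by linarith, by linarith, by linarith, by linarith⟩

lemma isCoprime_x₁_y₃ (h : SymCounted U x₁ x₂ x₃ y₁ y₂ y₃) : IsCoprime x₁ y₃ := by
  obtain ⟨-, -, ⟨c1, c2, c3⟩, ⟨d1, d2, d3⟩, e, -⟩ := h
  have hx : (Int.gcd x₁ y₃ : ℤ) ∣ x₁ := Int.gcd_dvd_left _ _
  have hy : (Int.gcd x₁ y₃ : ℤ) ∣ y₃ := Int.gcd_dvd_right _ _
  have hdvd : (Int.gcd x₁ y₃ : ℤ) ∣ x₂ * y₂ ^ 2 := by
    rw [show x₂ * y₂ ^ 2 = -(y₁ ^ 2 * x₁ + (x₃ * y₃) * y₃) by linarith]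
    exact ((hx.mul_left _).add (hy.mul_left _)).neg_right
  have h1 : IsCoprime (Int.gcd x₁ y₃ : ℤ) (x₂ * y₂ ^ 2) :=
    (c1.of_isCoprime_of_dvd_left hx).mul_right
      ((d3.symm.of_isCoprime_of_dvd_left hy).pow_right)
  have h2 := h1.isUnit_of_dvd' dvd_rfl hdvd
  rw [Int.isCoprime_iff_gcd_eq_one]
  simpa [Int.isUnit_iff] using h2

lemma exists_sq_le (h : SymCounted U x₁ x₂ x₃ y₁ y₂ y₃) :
    ((x₁ * x₂ * y₃ : ℤ) : ℝ) ^ 2 ≤ U ∨ ((x₃ * x₂ * y₁ : ℤ) : ℝ) ^ 2 ≤ U ∨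
      ((x₁ * x₃ * y₂ : ℤ) : ℝ) ^ 2 ≤ U := by
  obtain ⟨-, -, -, -, -, h1, h2, h3⟩ := h
  by_contra! hcon
  obtain ⟨g1, g2, g3⟩ := hcon
  have hU : 0 ≤ U := le_trans (by positivity) h1
  have lower : U * U * U < ((x₁ * x₂ * y₃ : ℤ) : ℝ) ^ 2 * ((x₃ * x₂ * y₁ : ℤ) : ℝ) ^ 2 *
      ((x₁ * x₃ * y₂ : ℤ) : ℝ) ^ 2 := by
    gcongr
  have upper := mul_le_mul (mul_le_mul h1 h2 (by positivity) hU) h3 (by positivity) (by positivity)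
  have heq : ∀ X₁ X₂ X₃ Y₁ Y₂ Y₃ : ℝ,
      |X₁| * Y₁ ^ 2 * (|X₁| * |X₂| * |X₃|) * (|X₂| * Y₂ ^ 2 * (|X₁| * |X₂| * |X₃|)) *
        (|X₃| * Y₃ ^ 2 * (|X₁| * |X₂| * |X₃|)) =
      (X₁ * X₂ * Y₃) ^ 2 * (X₃ * X₂ * Y₁) ^ 2 * (X₁ * X₃ * Y₂) ^ 2 := by
    intro X₁ X₂ X₃ Y₁ Y₂ Y₃
    calc _ = (|X₁| ^ 2) ^ 2 * (|X₂| ^ 2) ^ 2 * (|X₃| ^ 2) ^ 2 * (Y₁ * Y₂ * Y₃) ^ 2 := by ring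
      _ = _ := by
        simp only [sq_abs]
        ring
  rw [heq] at upper
  push_cast at lower
  linarith

lemma abs_le (h : SymCounted U x₁ x₂ x₃ y₁ y₂ y₃) :
    |(x₁ : ℝ)| ≤ U ∧ |(y₁ : ℝ)| ≤ U ∧ (|(x₁ : ℝ)| * (y₁ : ℝ) ^ 2 ≤ U) := by
  obtain ⟨⟨a1, a2, a3⟩, ⟨b1, b2, b3⟩, -, -, -, h1, -, -⟩ := h
  have habs : ∀ n : ℤ, n ≠ 0 → (1 : ℝ) ≤ |(n : ℝ)| := fun n hn => by
    exact_mod_cast Int.one_le_abs hn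
  have k1 := habs _ a1
  have ky := habs _ b1
  have k123 := one_le_mul_of_one_le_of_one_le (one_le_mul_of_one_le_of_one_le k1 (habs _ a2))
    (habs _ a3)
  have hmain : |(x₁ : ℝ)| * (y₁ : ℝ) ^ 2 ≤ U :=
    (le_mul_of_one_le_right (by positivity) k123).trans h1
  rw [← sq_abs (y₁ : ℝ)] at hmain
  have ky2 : 1 ≤ |(y₁ : ℝ)| ^ 2 := one_le_pow₀ ky
  refine ⟨(le_mul_of_one_le_right (by positivity) ky2).trans hmain, ?_, by rwa [sq_abs] at hmain⟩
  exact (le_self_pow₀ ky two_ne_zero).trans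
    ((le_mul_of_one_le_left (by positivity) k1).trans hmain)

end SymCounted

lemma sum_Icc_inv_abs_le {U : ℝ} (hU : 1 ≤ U) :
    ∑ n ∈ Finset.Icc (-(⌊U⌋₊ : ℤ)) ⌊U⌋₊, |(n : ℝ)|⁻¹ ≤ 2 * (1 + Real.log U) := by
  set N := ⌊U⌋₊
  have hN : N ≠ 0 := (Nat.floor_pos.2 hU).ne'
  have hH : ∑ n ∈ Finset.range (N + 1), (n : ℝ)⁻¹ ≤ 1 + Real.log U := by
    have h1 := harmonic_le_one_add_log N
    have h2 : Real.log N ≤ Real.log U :=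
      Real.log_le_log (by positivity) (Nat.floor_le (by linarith))
    rw [Finset.sum_range_succ']
    simp only [harmonic, Rat.cast_sum, Rat.cast_inv, Rat.cast_natCast] at h1
    simp only [Nat.cast_zero, inv_zero, add_zero]
    linarith
  have hsub : Finset.Icc (-(N : ℤ)) N ⊆ (Finset.range (N + 1)).image (fun n : ℕ => (n : ℤ)) ∪
      (Finset.range (N + 1)).image (fun n : ℕ => -(n : ℤ)) := by
    intro n hn
    rw [Finset.mem_Icc] at hn
    simp only [Finset.mem_union, Finset.mem_image, Finset.mem_range]
    rcases le_total 0 n with h | h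
    · exact Or.inl ⟨n.toNat, by omega, by omega⟩
    · exact Or.inr ⟨(-n).toNat, by omega, by omega⟩
  calc _ ≤ ∑ n ∈ (Finset.range (N + 1)).image (fun n : ℕ => (n : ℤ)) ∪
      (Finset.range (N + 1)).image (fun n : ℕ => -(n : ℤ)), |(n : ℝ)|⁻¹ :=
        Finset.sum_le_sum_of_subset_of_nonneg hsub fun _ _ _ => by positivity
    _ ≤ ∑ n ∈ (Finset.range (N + 1)).image (fun n : ℕ => (n : ℤ)), |(n : ℝ)|⁻¹ +
      ∑ n ∈ (Finset.range (N + 1)).image (fun n : ℕ => -(n : ℤ)), |(n : ℝ)|⁻¹ := by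
        rw [← Finset.sum_union_inter]
        exact le_add_of_nonneg_right (Finset.sum_nonneg fun _ _ => by positivity)
    _ = ∑ n ∈ Finset.range (N + 1), (n : ℝ)⁻¹ + ∑ n ∈ Finset.range (N + 1), (n : ℝ)⁻¹ := by
        rw [Finset.sum_image (fun _ _ _ _ h => by simpa using h),
          Finset.sum_image (fun _ _ _ _ h => by simpa using h)]
        simp
    _ ≤ _ := by linarith

lemma card_symCounted_fiber_le {U D : ℝ} (hU : 1 ≤ U)
    (hD : ∀ c : ℤ, c ≠ 0 → (c : ℝ) ^ 2 ≤ U → ((c.natAbs ^ 2).divisors.card : ℝ) ≤ D)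
    (a b c : ℤ) (F : Finset (ℤ × ℤ × ℤ × ℤ × ℤ × ℤ))
    (hF : ∀ v ∈ F, SymCounted U v.1 v.2.1 v.2.2.1 v.2.2.2.1 v.2.2.2.2.1 v.2.2.2.2.2 ∧
      ((v.1 * v.2.1 * v.2.2.2.2.2 : ℤ) : ℝ) ^ 2 ≤ U)
    (habc : ∀ v ∈ F, v.1 = a ∧ v.2.1 = b ∧ v.2.2.2.2.2 = c) :
    (F.card : ℝ) ≤ 40 * |D| * (Nat.log 2 ⌊U⌋₊ + 2 : ℕ) * √U *
      (|(a : ℝ)|⁻¹ * (|(b : ℝ)|⁻¹ * |(c : ℝ)|⁻¹)) := by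
  rcases F.eq_empty_or_nonempty with rfl | ⟨v₀, hv₀⟩
  · simp only [Finset.card_empty, Nat.cast_zero]
    positivity
  have habs : ∀ n : ℤ, n ≠ 0 → (1 : ℝ) ≤ |(n : ℝ)| := fun n hn => by
    exact_mod_cast Int.one_le_abs hn
  obtain ⟨ha, hb, hc, hac, hsq⟩ : a ≠ 0 ∧ b ≠ 0 ∧ c ≠ 0 ∧ IsCoprime a c ∧
      ((a * b * c : ℤ) : ℝ) ^ 2 ≤ U := by
    obtain ⟨rfl, rfl, rfl⟩ := habc v₀ hv₀
    obtain ⟨h, hs⟩ := hF v₀ hv₀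
    exact ⟨h.1.1, h.1.2.1, h.2.1.2.2, h.isCoprime_x₁_y₃, hs⟩
  have ka := habs _ ha
  have kb := habs _ hb
  have kc := habs _ hc
  set A := |(a : ℝ)| with hA
  set B := |(b : ℝ)| with hB
  have habcU : A * B * |(c : ℝ)| ≤ √U := by
    apply Real.le_sqrt_of_sq_le
    rw [hA, hB, ← abs_mul, ← abs_mul, sq_abs]
    exact_mod_cast hsq
  have hcU : (c : ℝ) ^ 2 ≤ U := by
    rw [← sq_abs]
    refine (Real.le_sqrt (by positivity) (by linarith)).1 (le_trans ?_ habcU)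
    exact le_mul_of_one_le_left (by positivity) (one_le_mul_of_one_le_of_one_le ka kb)
  set M := √U * |(c : ℝ)| / (√A * √B) with hM
  have hM0 : 0 ≤ M := by positivity
  let proj : ℤ × ℤ × ℤ × ℤ × ℤ × ℤ → ℤ × ℤ := fun v => (v.2.2.2.1, v.2.2.2.2.1)
  have hinj : Set.InjOn proj F := by
    rintro ⟨x₁, x₂, x₃, y₁, y₂, y₃⟩ hv ⟨x₁', x₂', x₃', y₁', y₂', y₃'⟩ hw hvw
    obtain ⟨rfl, rfl, rfl⟩ := habc _ hv
    obtain ⟨h1, h2, h3⟩ := habc _ hw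
    simp only [proj, Prod.mk.injEq] at hvw h1 h2 h3
    obtain ⟨rfl, rfl⟩ := hvw
    subst h1 h2 h3
    have e1 := (hF _ hv).1.2.2.2.2.1
    have e2 := (hF _ hw).1.2.2.2.2.1
    simp only at e1 e2 hc
    have : x₃ * y₃' ^ 2 = x₃' * y₃' ^ 2 := by linarith
    have := mul_right_cancel₀ (pow_ne_zero 2 hc) this
    rw [this]
  have hW : U < (2 : ℝ) ^ (Nat.log 2 ⌊U⌋₊ + 1) := by
    have h1 : ⌊U⌋₊ < 2 ^ (Nat.log 2 ⌊U⌋₊ + 1) := Nat.lt_pow_succ_log_self one_lt_two _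
    exact_mod_cast (Nat.floor_lt (zero_le_one.trans hU)).1 h1
  have hfib := card_fiber_le ha hb hc hac (Nat.log 2 ⌊U⌋₊ + 2) hM0 (F.image proj) (by
    intro y hy
    obtain ⟨⟨x₁, x₂, x₃, y₁, y₂, y₃⟩, hv, rfl⟩ := Finset.mem_image.1 hy
    obtain ⟨h, -⟩ := hF _ hv
    obtain ⟨rfl, rfl, rfl⟩ := habc _ hv
    simp only at h
    have hy1 := h.abs_le.2.2
    have hy2 : |(x₂ : ℝ)| * (y₂ : ℝ) ^ 2 ≤ U :=
      h.swap_two_three.swap_one_three.abs_le.2.2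
    obtain ⟨-, ⟨b1, b2, b3⟩, -, ⟨d1, d2, d3⟩, e, -, -, h3⟩ := h
    refine ⟨b1, b2, d1, d2, d3, ⟨-x₃, by simp only [proj]; linarith⟩, ?_, ?_⟩
    · have e' : ((x₁ : ℝ) * (y₁ : ℝ) ^ 2 + (x₂ : ℝ) * (y₂ : ℝ) ^ 2) =
          -((x₃ : ℝ) * (y₃ : ℝ) ^ 2) := by
        have : (x₁ : ℝ) * (y₁ : ℝ) ^ 2 + (x₂ : ℝ) * (y₂ : ℝ) ^ 2 + (x₃ : ℝ) * (y₃ : ℝ) ^ 2 = 0 := by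
          exact_mod_cast e
        linarith
      simp only [proj]
      rw [e', abs_neg, abs_mul, abs_pow, hM, le_div_iff₀ (by positivity)]
      have : |(x₃ : ℝ)| * |(y₃ : ℝ)| * (√A * √B) ≤ √U := by
        apply Real.le_sqrt_of_sq_le
        rw [mul_pow, mul_pow, mul_pow, Real.sq_sqrt (by positivity), Real.sq_sqrt (by positivity),
          sq_abs (y₃ : ℝ)]
        refine le_trans (le_of_eq ?_) h3
        simp only [hA, hB]
        ring
      calc |(x₃ : ℝ)| * |(y₃ : ℝ)| ^ 2 * (√A * √B) =
            |(x₃ : ℝ)| * |(y₃ : ℝ)| * (√A * √B) * |(y₃ : ℝ)| := by ring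
        _ ≤ _ := by gcongr
    · have bound : ∀ X Y : ℝ, |X| * Y ^ 2 ≤ U → √|X| * |Y| ≤ U := by
        intro X Y hXY
        have h1 : (√|X| * |Y|) ^ 2 ≤ U := by
          rwa [mul_pow, Real.sq_sqrt (abs_nonneg _), sq_abs]
        have h2 : 0 ≤ √|X| * |Y| := by positivity
        nlinarith
      have g1 := bound _ _ hy1
      have g2 := bound _ _ hy2
      simp only [proj]
      rw [pow_succ]
      linarith)
  rw [Finset.card_image_of_injOn hinj] at hfib
  refine hfib.trans ?_
  have hK : 2 * (4 * M / (√A * √B * (c : ℝ) ^ 2)) + 2 ≤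
      10 * √U * (A⁻¹ * (B⁻¹ * |(c : ℝ)|⁻¹)) := by
    have h1 : 4 * M / (√A * √B * (c : ℝ) ^ 2) = 4 * √U * (A⁻¹ * (B⁻¹ * |(c : ℝ)|⁻¹)) := by
      have hsA : √A ^ 2 = A := Real.sq_sqrt (by positivity)
      have hsB : √B ^ 2 = B := Real.sq_sqrt (by positivity)
      rw [hM, ← sq_abs (c : ℝ)]
      have : 0 < |(c : ℝ)| := by positivity
      have hA0 : A ≠ 0 := by positivity
      have hB0 : B ≠ 0 := by positivity
      have hsA0 : √A ≠ 0 := by positivity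
      have hsB0 : √B ≠ 0 := by positivity
      calc _ = 4 * √U * ((√A ^ 2)⁻¹ * ((√B ^ 2)⁻¹ * |(c : ℝ)|⁻¹)) := by field_simp
        _ = _ := by rw [hsA, hsB]
    have h2 : 1 ≤ √U * (A⁻¹ * (B⁻¹ * |(c : ℝ)|⁻¹)) := by
      rw [← mul_inv, ← mul_inv, ← mul_assoc, ← div_eq_mul_inv, le_div_iff₀ (by positivity), one_mul]
      exact habcU
    rw [h1]
    linarith
  have hDc := (hD c hc hcU).trans (le_abs_self D)
  calc _ ≤ 4 * |D| * ((Nat.log 2 ⌊U⌋₊ + 2 : ℕ) : ℝ) *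
        (10 * √U * (A⁻¹ * (B⁻¹ * |(c : ℝ)|⁻¹))) := by gcongr
    _ = _ := by ring

lemma card_symCounted_le {U D : ℝ} (hU : 1 ≤ U)
    (hD : ∀ c : ℤ, c ≠ 0 → (c : ℝ) ^ 2 ≤ U → ((c.natAbs ^ 2).divisors.card : ℝ) ≤ D)
    (F : Finset (ℤ × ℤ × ℤ × ℤ × ℤ × ℤ))
    (hF : ∀ v ∈ F, SymCounted U v.1 v.2.1 v.2.2.1 v.2.2.2.1 v.2.2.2.2.1 v.2.2.2.2.2 ∧
      ((v.1 * v.2.1 * v.2.2.2.2.2 : ℤ) : ℝ) ^ 2 ≤ U) :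
    (F.card : ℝ) ≤ 40 * |D| * (Nat.log 2 ⌊U⌋₊ + 2 : ℕ) * √U * (2 * (1 + Real.log U)) ^ 3 := by
  let key : ℤ × ℤ × ℤ × ℤ × ℤ × ℤ → ℤ × ℤ × ℤ := fun v => (v.1, v.2.1, v.2.2.2.2.2)
  let I := Finset.Icc (-(⌊U⌋₊ : ℤ)) ⌊U⌋₊
  have hI : ∀ n : ℤ, |(n : ℝ)| ≤ U → n ∈ I := by
    intro n hn
    have : n.natAbs ≤ ⌊U⌋₊ := Nat.le_floor (by rwa [Nat.cast_natAbs, Int.cast_abs])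
    rw [Finset.mem_Icc]
    omega
  have hmaps : ∀ v ∈ F, key v ∈ I ×ˢ I ×ˢ I := by
    intro v hv
    have h := (hF v hv).1
    simp only [key, Finset.mem_product]
    exact ⟨hI _ h.abs_le.1, hI _ h.swap_two_three.swap_one_three.abs_le.1,
      hI _ h.swap_one_three.abs_le.2.1⟩
  rw [Finset.card_eq_sum_card_fiberwise hmaps, Nat.cast_sum]
  have hlog : 0 ≤ Real.log U := Real.log_nonneg hU
  calc _ ≤ ∑ k ∈ I ×ˢ I ×ˢ I, 40 * |D| * (Nat.log 2 ⌊U⌋₊ + 2 : ℕ) * √U *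
        (|(k.1 : ℝ)|⁻¹ * (|(k.2.1 : ℝ)|⁻¹ * |(k.2.2 : ℝ)|⁻¹)) := by
        refine Finset.sum_le_sum fun k _ => card_symCounted_fiber_le hU hD k.1 k.2.1 k.2.2 _
          (fun v hv => hF v (Finset.mem_filter.1 hv).1) fun v hv => ?_
        have := (Finset.mem_filter.1 hv).2
        simp [← this, key]
    _ = 40 * |D| * (Nat.log 2 ⌊U⌋₊ + 2 : ℕ) * √U * (∑ n ∈ I, |(n : ℝ)|⁻¹) ^ 3 := by
        rw [← Finset.mul_sum, Finset.sum_product]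
        simp only [← Finset.mul_sum, Finset.sum_product, ← Finset.sum_mul]
        ring
    _ ≤ _ := by
        gcongr
        exact sum_Icc_inv_abs_le hU

lemma StackyCounted.symCounted {T : ℝ} {x₁ x₂ x₃ y₁ y₂ y₃ : ℤ}
    (h : StackyCounted T x₁ x₂ x₃ y₁ y₂ y₃) : SymCounted (2 * T) x₁ x₂ (-x₃) y₁ y₂ y₃ := by
  obtain ⟨a1, a2, a3, b1, b2, b3, c1, c2, c3, d1, d2, d3, -, -, -, e, hpos, hle, hT⟩ := h
  rw [← Int.isCoprime_iff_gcd_eq_one] at c1 c2 c3 d1 d2 d3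
  have e' : (x₁ : ℝ) * (y₁ : ℝ) ^ 2 + (x₂ : ℝ) * (y₂ : ℝ) ^ 2 = (x₃ : ℝ) * (y₃ : ℝ) ^ 2 := by
    exact_mod_cast e
  have hpos' : (0 : ℝ) < x₁ := by exact_mod_cast hpos
  have hle' : |(x₂ : ℝ)| * (y₂ : ℝ) ^ 2 ≤ |(x₁ : ℝ)| * (y₁ : ℝ) ^ 2 := by
    have : |(x₂ : ℝ) * (y₂ : ℝ) ^ 2| ≤ x₁ * (y₁ : ℝ) ^ 2 := by exact_mod_cast hle
    rwa [abs_mul, abs_of_nonneg (sq_nonneg (y₂ : ℝ)), ← abs_of_pos hpos'] at this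
  have h3 : |(x₃ : ℝ)| * (y₃ : ℝ) ^ 2 ≤ 2 * (|(x₁ : ℝ)| * (y₁ : ℝ) ^ 2) := by
    have := abs_add_le ((x₁ : ℝ) * (y₁ : ℝ) ^ 2) ((x₂ : ℝ) * (y₂ : ℝ) ^ 2)
    rw [e', abs_mul, abs_mul, abs_mul, abs_of_nonneg (sq_nonneg (y₁ : ℝ)),
      abs_of_nonneg (sq_nonneg (y₂ : ℝ)), abs_of_nonneg (sq_nonneg (y₃ : ℝ))] at this
    linarith
  set P := |(x₁ : ℝ)| * |(x₂ : ℝ)| * |(x₃ : ℝ)| with hP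
  have hT' : |(x₁ : ℝ)| * (y₁ : ℝ) ^ 2 * P ≤ T := by
    refine le_trans (le_of_eq ?_) hT
    push_cast
    rw [abs_mul, abs_mul, abs_pow, abs_mul, hP, ← sq_abs (y₁ : ℝ)]
    ring
  have hP0 : 0 ≤ P := by positivity
  have hT0 : 0 ≤ T := le_trans (by positivity) hT'
  refine ⟨⟨a1, a2, neg_ne_zero.2 a3⟩, ⟨b1, b2, b3⟩, ⟨c1, c2.neg_right, c3.neg_right⟩,
    ⟨d1, d2, d3⟩, by linarith, ?_, ?_, ?_⟩ <;> rw [Int.cast_neg, abs_neg, ← hP]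
  · linarith
  · linarith [mul_le_mul_of_nonneg_right hle' hP0]
  · linarith [mul_le_mul_of_nonneg_right h3 hP0]

lemma stackyN_le {T D : ℝ} (hT : 1 ≤ 2 * T)
    (hD : ∀ c : ℤ, c ≠ 0 → (c : ℝ) ^ 2 ≤ 2 * T → ((c.natAbs ^ 2).divisors.card : ℝ) ≤ D) :
    (stackyN T : ℝ) ≤ 3 * (40 * |D| * (Nat.log 2 ⌊2 * T⌋₊ + 2 : ℕ) * √(2 * T) *
      (2 * (1 + Real.log (2 * T))) ^ 3) := by
  classical
  set U := 2 * T with hU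
  let I := Finset.Icc (-(⌊U⌋₊ : ℤ)) ⌊U⌋₊
  have hI : ∀ n : ℤ, |(n : ℝ)| ≤ U → n ∈ I := by
    intro n hn
    have : n.natAbs ≤ ⌊U⌋₊ := Nat.le_floor (by rwa [Nat.cast_natAbs, Int.cast_abs])
    rw [Finset.mem_Icc]
    omega
  let S : Finset (ℤ × ℤ × ℤ × ℤ × ℤ × ℤ) := (I ×ˢ I ×ˢ I ×ˢ I ×ˢ I ×ˢ I).filter fun v =>
    SymCounted U v.1 v.2.1 v.2.2.1 v.2.2.2.1 v.2.2.2.2.1 v.2.2.2.2.2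
  have hS : stackyN T ≤ S.card := by
    rw [stackyN, ← Set.ncard_coe_finset]
    refine Set.ncard_le_ncard_of_injOn
      (fun v => (v.1, v.2.1, -v.2.2.1, v.2.2.2.1, v.2.2.2.2.1, v.2.2.2.2.2)) ?_ ?_
      S.finite_toSet
    · intro v hv
      have h := StackyCounted.symCounted hv
      simp only [S, Finset.coe_filter, Set.mem_ofPred_eq, Finset.mem_product]
      exact ⟨⟨hI _ h.abs_le.1, hI _ h.swap_two_three.swap_one_three.abs_le.1,
        hI _ h.swap_one_three.abs_le.1, hI _ h.abs_le.2.1,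
        hI _ h.swap_two_three.swap_one_three.abs_le.2.1, hI _ h.swap_one_three.abs_le.2.1⟩, h⟩
    · rintro ⟨x₁, x₂, x₃, y₁, y₂, y₃⟩ - ⟨x₁', x₂', x₃', y₁', y₂', y₃'⟩ - h
      simpa using h
  let F (k : ℤ × ℤ × ℤ × ℤ × ℤ × ℤ → ℤ) := S.filter fun v => (k v : ℝ) ^ 2 ≤ U
  have hcover : S ⊆ F (fun v => v.1 * v.2.1 * v.2.2.2.2.2) ∪
      (F (fun v => v.2.2.1 * v.2.1 * v.2.2.2.1) ∪
        F (fun v => v.1 * v.2.2.1 * v.2.2.2.2.1)) := by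
    intro v hv
    simp only [F, Finset.mem_union, Finset.mem_filter, hv, true_and]
    exact (Finset.mem_filter.1 hv).2.exists_sq_le
  set R := 40 * |D| * (Nat.log 2 ⌊U⌋₊ + 2 : ℕ) * √U * (2 * (1 + Real.log U)) ^ 3 with hR
  have hmem : ∀ k, ∀ v ∈ F k, SymCounted U v.1 v.2.1 v.2.2.1 v.2.2.2.1 v.2.2.2.2.1 v.2.2.2.2.2 ∧
      (k v : ℝ) ^ 2 ≤ U := by
    intro k v hv
    simp only [F, S, Finset.mem_filter] at hv
    exact ⟨hv.1.2, hv.2⟩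
  have hcardF : ∀ k, ∀ σ : ℤ × ℤ × ℤ × ℤ × ℤ × ℤ → ℤ × ℤ × ℤ × ℤ × ℤ × ℤ, σ.Injective →
      (∀ v ∈ F k, SymCounted U (σ v).1 (σ v).2.1 (σ v).2.2.1 (σ v).2.2.2.1 (σ v).2.2.2.2.1
        (σ v).2.2.2.2.2 ∧ (((σ v).1 * (σ v).2.1 * (σ v).2.2.2.2.2 : ℤ) : ℝ) ^ 2 ≤ U) →
      ((F k).card : ℝ) ≤ R := by
    intro k σ hσ h
    rw [← Finset.card_image_of_injective (F k) hσ]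
    refine card_symCounted_le hT hD _ fun w hw => ?_
    obtain ⟨v, hv, rfl⟩ := Finset.mem_image.1 hw
    exact h v hv
  clear_value F
  have h1 := hcardF (fun v => v.1 * v.2.1 * v.2.2.2.2.2) id Function.injective_id
    fun v hv => hmem _ v hv
  have h2 := hcardF (fun v => v.2.2.1 * v.2.1 * v.2.2.2.1)
    (fun v => (v.2.2.1, v.2.1, v.1, v.2.2.2.2.2, v.2.2.2.2.1, v.2.2.2.1)) (by
      rintro ⟨x₁, x₂, x₃, y₁, y₂, y₃⟩ ⟨x₁', x₂', x₃', y₁', y₂', y₃'⟩ h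
      simp only [Prod.mk.injEq] at h ⊢
      obtain ⟨e1, e2, e3, e4, e5, e6⟩ := h
      exact ⟨e3, e2, e1, e6, e5, e4⟩)
    fun v hv => ⟨(hmem _ v hv).1.swap_one_three, (hmem _ v hv).2⟩
  have h3 := hcardF (fun v => v.1 * v.2.2.1 * v.2.2.2.2.1)
    (fun v => (v.1, v.2.2.1, v.2.1, v.2.2.2.1, v.2.2.2.2.2, v.2.2.2.2.1)) (by
      rintro ⟨x₁, x₂, x₃, y₁, y₂, y₃⟩ ⟨x₁', x₂', x₃', y₁', y₂', y₃'⟩ h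
      simp only [Prod.mk.injEq] at h ⊢
      obtain ⟨e1, e2, e3, e4, e5, e6⟩ := h
      exact ⟨e1, e3, e2, e4, e6, e5⟩)
    fun v hv => ⟨(hmem _ v hv).1.swap_two_three, (hmem _ v hv).2⟩
  have hcard := hS.trans ((Finset.card_le_card hcover).trans ((Finset.card_union_le _ _).trans
    (Nat.add_le_add_left (Finset.card_union_le _ _) _)))
  have hcard' : (stackyN T : ℝ) ≤ _ := Nat.cast_le.2 hcard
  push_cast at hcard'
  linarith

theorem stackyN_upper_epsilon :
    ∀ ε : ℝ, 0 < ε → ∃ C : ℝ, 0 < C ∧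
      ∀ T : ℝ, 2 ≤ T → (stackyN T : ℝ) ≤ C * T ^ ((1 : ℝ) / 2 + ε) := by
  intro ε hε
  obtain ⟨η, hη, hηε⟩ : ∃ η : ℝ, 0 < η ∧ ε = 5 * η := ⟨ε / 5, by positivity, by ring⟩
  obtain ⟨C, hC, hdiv⟩ := card_divisors_le_rpow η hη
  set L := 1 + 1 / η with hL
  refine ⟨1920 * C * L ^ 4 * 2 ^ ((1 : ℝ) / 2 + ε), by positivity, fun T hT => ?_⟩
  set U := 2 * T with hU
  have hU1 : 1 ≤ U := by linarith
  have hU0 : 0 < U := by linarith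
  have hUη : 1 ≤ U ^ η := Real.one_le_rpow hU1 hη.le
  have hlog0 : 0 ≤ Real.log U := Real.log_nonneg hU1
  have hlog : 1 + Real.log U ≤ L * U ^ η := by
    have h1 := Real.log_le_rpow_div hU0.le hη
    have h2 : L * U ^ η = U ^ η + U ^ η / η := by
      rw [hL]
      ring
    linarith
  have hW : ((Nat.log 2 ⌊U⌋₊ + 2 : ℕ) : ℝ) ≤ 2 * (L * U ^ η) := by
    refine le_trans ?_ (mul_le_mul_of_nonneg_left hlog two_pos.le)
    have h1 : (2 : ℝ) ^ Nat.log 2 ⌊U⌋₊ ≤ U := by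
      have := Nat.pow_log_le_self 2 (Nat.floor_pos.2 hU1).ne'
      calc (2 : ℝ) ^ Nat.log 2 ⌊U⌋₊ ≤ (⌊U⌋₊ : ℝ) := by exact_mod_cast this
        _ ≤ U := Nat.floor_le hU0.le
    have h2 := Real.log_le_log (by positivity) h1
    rw [Real.log_pow] at h2
    have h3 := Real.log_two_gt_d9
    have h4 : (0 : ℝ) ≤ Nat.log 2 ⌊U⌋₊ := by positivity
    push_cast
    nlinarith
  have hmain := stackyN_le (T := T) (D := C * U ^ η) hU1 (by
    intro c hc hcU
    refine (hdiv _ (by simpa using hc)).trans ?_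
    gcongr
    rw [Nat.cast_pow, Nat.cast_natAbs, Int.cast_abs, sq_abs]
    exact hcU)
  rw [← hU, abs_of_pos (by positivity)] at hmain
  refine hmain.trans ?_
  calc _ ≤ 3 * (40 * (C * U ^ η) * (2 * (L * U ^ η)) * √U * (2 * (L * U ^ η)) ^ 3) := by gcongr
    _ = 1920 * C * L ^ 4 * (√U * (U ^ η) ^ 5) := by ring
    _ = 1920 * C * L ^ 4 * U ^ ((1 : ℝ) / 2 + ε) := by
      rw [Real.rpow_add hU0, ← Real.sqrt_eq_rpow, ← Real.rpow_natCast (U ^ η), ← Real.rpow_mul hU0.le,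
        hηε, mul_comm η]
      norm_num
    _ = 1920 * C * L ^ 4 * 2 ^ ((1 : ℝ) / 2 + ε) * T ^ ((1 : ℝ) / 2 + ε) := by
      rw [hU, Real.mul_rpow two_pos.le (by linarith)]
      ring
end

section
/- There exist positive real numbers c1, c2, c3 such that for all T > c3, the number of triples (y1, y2, y3) of nonzero pairwise coprime integers satisfying y1^2 + y2^2 = y3^2 and max(y1^2, y2^2) ≤ T lies strictly between c1 * T^(1/2) and c2 * T^(1/2). -/
open Real

/-- The number of primitive Pythagorean triples (all coordinates nonzero, pairwise
coprime) with `max (y1^2) (y2^2) ≤ T`. -/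
noncomputable def pythCount (T : ℝ) : ℕ :=
  Set.ncard {v : ℤ × ℤ × ℤ |
    v.1 ≠ 0 ∧ v.2.1 ≠ 0 ∧ v.2.2 ≠ 0 ∧
    Int.gcd v.1 v.2.1 = 1 ∧ Int.gcd v.1 v.2.2 = 1 ∧ Int.gcd v.2.1 v.2.2 = 1 ∧
    v.1 ^ 2 + v.2.1 ^ 2 = v.2.2 ^ 2 ∧
    ((max (v.1 ^ 2) (v.2.1 ^ 2) : ℤ) : ℝ) ≤ T}

/-- The set counted by `pythCount`. -/
def pythSet (T : ℝ) : Set (ℤ × ℤ × ℤ) :=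
  {v : ℤ × ℤ × ℤ |
    v.1 ≠ 0 ∧ v.2.1 ≠ 0 ∧ v.2.2 ≠ 0 ∧
    Int.gcd v.1 v.2.1 = 1 ∧ Int.gcd v.1 v.2.2 = 1 ∧ Int.gcd v.2.1 v.2.2 = 1 ∧
    v.1 ^ 2 + v.2.1 ^ 2 = v.2.2 ^ 2 ∧
    ((max (v.1 ^ 2) (v.2.1 ^ 2) : ℤ) : ℝ) ≤ T}

/-- The Pythagorean triple with parameters `m`, `n`, with optional swap of the legs and
optional sign change of the hypotenuse. -/
def pythParam (q : (Bool × Bool) × ℤ × ℤ) : ℤ × ℤ × ℤ :=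
  let x := q.2.1 ^ 2 - q.2.2 ^ 2
  let y := 2 * q.2.1 * q.2.2
  let z := q.2.1 ^ 2 + q.2.2 ^ 2
  (if q.1.1 then x else y, if q.1.1 then y else x, if q.1.2 then z else -z)

/-- A finite set of parameters covering all primitive triples with parameters at most `B`. -/
noncomputable def pythBox (B : ℕ) : Finset ((Bool × Bool) × ℤ × ℤ) :=
  Finset.univ ×ˢ (Finset.Icc (-B : ℤ) B ×ˢ Finset.Icc (-B : ℤ) B)

lemma card_pythBox (B : ℕ) : (pythBox B).card = 4 * (2 * B + 1) ^ 2 := by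
  have h : ((B : ℤ) + 1 - -(B : ℤ)).toNat = 2 * B + 1 := by lia
  simp only [pythBox, Finset.card_product, Int.card_Icc, h, Finset.card_univ,
    Fintype.card_prod, Fintype.card_bool]
  ring

lemma pythSet_subset_image (T : ℝ) (hT : 0 ≤ T) :
    pythSet T ⊆ ((pythBox ⌊√(2 * √T)⌋₊).image pythParam : Finset (ℤ × ℤ × ℤ)) := by
  rintro ⟨x, y, z⟩ ⟨-, -, -, hxy, -, -, hxyz, hmax⟩
  simp only at hxy hxyz hmax
  have hp : PythagoreanTriple x y z := by unfold PythagoreanTriple; linarith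
  obtain ⟨m, n, hx, hz, -, -⟩ := PythagoreanTriple.coprime_classification.mp ⟨hp, hxy⟩
  have hmn : (m ^ 2 + n ^ 2) ^ 2 = z ^ 2 := by rcases hz with rfl | rfl <;> ring
  have hx2 : ((x ^ 2 : ℤ) : ℝ) ≤ T := le_trans (by exact_mod_cast le_max_left _ _) hmax
  have hy2 : ((y ^ 2 : ℤ) : ℝ) ≤ T := le_trans (by exact_mod_cast le_max_right _ _) hmax
  have hR : ((m : ℝ) ^ 2 + n ^ 2) ^ 2 ≤ 2 * T := by
    have h1 : ((m : ℝ) ^ 2 + n ^ 2) ^ 2 = x ^ 2 + y ^ 2 := by exact_mod_cast hmn.trans hxyz.symm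
    push_cast at hx2 hy2
    linarith
  have hS : (m : ℝ) ^ 2 + n ^ 2 ≤ 2 * √T := by
    refine (sq_le_sq₀ (by positivity) (by positivity)).mp ?_
    rw [mul_pow, Real.sq_sqrt hT]
    linarith
  have key : ∀ k : ℤ, (k : ℝ) ^ 2 ≤ 2 * √T →
      k ∈ Finset.Icc (-(⌊√(2 * √T)⌋₊ : ℤ)) ⌊√(2 * √T)⌋₊ := by
    intro k hk
    have h1 : k.natAbs ≤ ⌊√(2 * √T)⌋₊ := by
      apply Nat.le_floor
      rw [Nat.cast_natAbs, Int.cast_abs]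
      exact Real.abs_le_sqrt hk
    rw [Finset.mem_Icc]
    lia
  have hm := key m (by nlinarith)
  have hn := key n (by nlinarith)
  rw [Finset.mem_coe, Finset.mem_image]
  have hmem : ∀ b : Bool × Bool, (b, m, n) ∈ pythBox ⌊√(2 * √T)⌋₊ := fun b =>
    Finset.mem_product.mpr ⟨Finset.mem_univ _, Finset.mem_product.mpr ⟨hm, hn⟩⟩
  rcases hx with ⟨rfl, rfl⟩ | ⟨rfl, rfl⟩ <;> rcases hz with rfl | rfl
  · exact ⟨((true, true), m, n), hmem _, by simp [pythParam]⟩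
  · exact ⟨((true, false), m, n), hmem _, by simp [pythParam]⟩
  · exact ⟨((false, true), m, n), hmem _, by simp [pythParam]⟩
  · exact ⟨((false, false), m, n), hmem _, by simp [pythParam]⟩

lemma pythSet_finite (T : ℝ) (hT : 0 ≤ T) : (pythSet T).Finite :=
  (Finset.finite_toSet _).subset (pythSet_subset_image T hT)

lemma pythCount_lt (T : ℝ) (hT : 1 ≤ T) : (pythCount T : ℝ) < 73 * √T := by
  set B := ⌊√(2 * √T)⌋₊
  have hs : 1 ≤ √T := Real.one_le_sqrt.mpr hT
  have hcard : pythCount T ≤ 4 * (2 * B + 1) ^ 2 := by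
    rw [← card_pythBox]
    refine le_trans (Set.ncard_le_ncard (pythSet_subset_image T (by linarith))
      (Finset.finite_toSet _)) ?_
    rw [Set.ncard_coe_finset]
    exact Finset.card_image_le
  have hB1 : 1 ≤ B := Nat.le_floor (by rw [Nat.cast_one, Real.one_le_sqrt]; linarith)
  have hB2 : (B : ℝ) ^ 2 ≤ 2 * √T := by
    rw [← Real.le_sqrt' (by exact_mod_cast hB1)]
    exact Nat.floor_le (Real.sqrt_nonneg _)
  have hB1' : (1 : ℝ) ≤ B := by exact_mod_cast hB1
  have hcard' : (pythCount T : ℝ) ≤ 4 * (2 * B + 1) ^ 2 := by exact_mod_cast hcard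
  nlinarith

/-- Indices `(a, b)` of the pairs `(2 * a, 2 * b + 1)` in a box. -/
def pairBox (K : ℕ) : Finset (ℕ × ℕ) := Finset.Icc 1 K ×ˢ Finset.range K

/-- Indices `(a, b)` in a box for which `2 * a` and `2 * b + 1` are coprime. -/
def coprimeBox (K : ℕ) : Finset (ℕ × ℕ) :=
  (pairBox K).filter fun p => Nat.Coprime (2 * p.1) (2 * p.2 + 1)

lemma card_filter_dvd_pairBox_le (K g : ℕ) (hg : 0 < g) :
    ((pairBox K).filter fun p => g ∣ p.1 ∧ g ∣ 2 * p.2 + 1).card ≤ (K / g) * (2 * K / g) := by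
  have h : (K / g) * (2 * K / g)
      = (Finset.Icc 1 (K / g) ×ˢ Finset.Icc 1 (2 * K / g)).card := by simp
  rw [h]
  apply Finset.card_le_card_of_injOn fun p => (p.1 / g, (2 * p.2 + 1) / g)
  · rintro ⟨a, b⟩ hp
    simp only [pairBox, Finset.coe_filter, Finset.mem_product, Finset.mem_Icc, Finset.mem_range,
      Set.mem_ofPred_eq] at hp
    obtain ⟨⟨⟨ha1, haK⟩, hb⟩, hga, hgb⟩ := hp
    simp only [Finset.coe_product, Set.mem_prod, Finset.mem_coe, Finset.mem_Icc]
    exact ⟨⟨Nat.div_pos (Nat.le_of_dvd ha1 hga) hg, Nat.div_le_div_right haK⟩,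
      Nat.div_pos (Nat.le_of_dvd (by lia) hgb) hg, Nat.div_le_div_right (by lia)⟩
  · rintro ⟨a, b⟩ hp ⟨a', b'⟩ hp' heq
    simp only [Finset.coe_filter, Set.mem_ofPred_eq] at hp hp'
    simp only [Prod.mk.injEq] at heq ⊢
    have h1 := Nat.div_mul_cancel hp.2.1
    have h2 := Nat.div_mul_cancel hp'.2.1
    have h3 := Nat.div_mul_cancel hp.2.2
    have h4 := Nat.div_mul_cancel hp'.2.2
    rw [heq.1] at h1
    rw [heq.2] at h3
    constructor <;> lia

lemma pairBox_sdiff_subset (K : ℕ) :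
    pairBox K \ coprimeBox K ⊆ (Finset.Icc 1 K).biUnion fun j =>
      (pairBox K).filter fun p => 2 * j + 1 ∣ p.1 ∧ 2 * j + 1 ∣ 2 * p.2 + 1 := by
  rintro ⟨a, b⟩ hp
  simp only [coprimeBox, Finset.mem_sdiff, Finset.mem_filter, not_and] at hp
  obtain ⟨hbox, hnc⟩ := hp
  obtain ⟨p, hp, hpa, hpb⟩ := Nat.Prime.not_coprime_iff_dvd.mp (hnc hbox)
  have hp2 : p ≠ 2 := by rintro rfl; lia
  obtain ⟨j, rfl⟩ := hp.odd_of_ne_two hp2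
  have hpa' : 2 * j + 1 ∣ a :=
    (hp.dvd_mul.mp hpa).resolve_left fun h =>
      hp2 ((Nat.prime_dvd_prime_iff_eq hp Nat.prime_two).mp h)
  have hbox' := hbox
  simp only [pairBox, Finset.mem_product, Finset.mem_Icc, Finset.mem_range] at hbox'
  have hle := Nat.le_of_dvd (by lia) hpa'
  have htwo := hp.two_le
  simp only [Finset.mem_biUnion, Finset.mem_filter, Finset.mem_Icc]
  exact ⟨j, ⟨by lia, by lia⟩, hbox, hpa', hpb⟩

lemma sum_inv_odd_sq_le (K : ℕ) :
    ∑ j ∈ Finset.Icc 1 K, 1 / (2 * (j : ℝ) + 1) ^ 2 ≤ (1 / 4) * (1 - 1 / ((K : ℝ) + 1)) := by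
  induction K with
  | zero => simp
  | succ K ih =>
    rw [Finset.sum_Icc_succ_top (by lia)]
    push_cast
    have h : 1 / (2 * ((K : ℝ) + 1) + 1) ^ 2
        ≤ (1 / 4) * (1 / ((K : ℝ) + 1) - 1 / ((K : ℝ) + 1 + 1)) := by
      have h1 : (1 / 4) * (1 / ((K : ℝ) + 1) - 1 / ((K : ℝ) + 1 + 1))
          = 1 / (4 * ((K : ℝ) + 1) * ((K : ℝ) + 1 + 1)) := by field_simp; ring
      rw [h1]
      apply one_div_le_one_div_of_le (by positivity)
      nlinarith
    linarith

lemma le_card_coprimeBox (K : ℕ) : (K : ℝ) ^ 2 / 2 ≤ (coprimeBox K).card := by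
  have hbad : ((pairBox K \ coprimeBox K).card : ℝ) ≤ (K : ℝ) ^ 2 / 2 := by
    have h1 := (Finset.card_le_card (pairBox_sdiff_subset K)).trans Finset.card_biUnion_le
    have h2 : ((pairBox K \ coprimeBox K).card : ℝ)
        ≤ ∑ j ∈ Finset.Icc 1 K, (((pairBox K).filter
          fun p => 2 * j + 1 ∣ p.1 ∧ 2 * j + 1 ∣ 2 * p.2 + 1).card : ℝ) := by
      exact_mod_cast h1
    have h3 : ∀ j ∈ Finset.Icc 1 K, (((pairBox K).filter
          fun p => 2 * j + 1 ∣ p.1 ∧ 2 * j + 1 ∣ 2 * p.2 + 1).card : ℝ)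
          ≤ 2 * (K : ℝ) ^ 2 * (1 / (2 * (j : ℝ) + 1) ^ 2) := by
      intro j _
      have h4 : (((pairBox K).filter
          fun p => 2 * j + 1 ∣ p.1 ∧ 2 * j + 1 ∣ 2 * p.2 + 1).card : ℝ)
          ≤ ((K / (2 * j + 1) : ℕ) : ℝ) * ((2 * K / (2 * j + 1) : ℕ) : ℝ) := by
        exact_mod_cast card_filter_dvd_pairBox_le K (2 * j + 1) (by lia)
      have h5 : ((K / (2 * j + 1) : ℕ) : ℝ) ≤ (K : ℝ) / (2 * j + 1) := by
        exact_mod_cast Nat.cast_div_le (α := ℝ) (m := K) (n := 2 * j + 1)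
      have h6 : ((2 * K / (2 * j + 1) : ℕ) : ℝ) ≤ (2 * K : ℝ) / (2 * j + 1) := by
        exact_mod_cast Nat.cast_div_le (α := ℝ) (m := 2 * K) (n := 2 * j + 1)
      calc _ ≤ _ := h4
        _ ≤ (K : ℝ) / (2 * j + 1) * ((2 * K : ℝ) / (2 * j + 1)) := by gcongr
        _ = _ := by field_simp
    have h7 := h2.trans (Finset.sum_le_sum h3)
    rw [← Finset.mul_sum] at h7
    have h8 : ∑ j ∈ Finset.Icc 1 K, 1 / (2 * (j : ℝ) + 1) ^ 2 ≤ 1 / 4 := by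
      refine (sum_inv_odd_sq_le K).trans ?_
      have : 0 ≤ 1 / ((K : ℝ) + 1) := by positivity
      linarith
    nlinarith [sq_nonneg (K : ℝ)]
  have htot : (pairBox K).card = K ^ 2 := by simp [pairBox, sq]
  have hsum : (pairBox K \ coprimeBox K).card + (coprimeBox K).card = (pairBox K).card :=
    Finset.card_sdiff_add_card_eq_card (Finset.filter_subset _ _)
  rw [htot] at hsum
  have hsum' : ((pairBox K \ coprimeBox K).card : ℝ) + (coprimeBox K).card = (K : ℝ) ^ 2 := by
    exact_mod_cast hsum
  linarith

/-- The Pythagorean triple with parameters `2 * a`, `2 * b + 1`. -/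
def oddPyth (p : ℕ × ℕ) : ℤ × ℤ × ℤ := pythParam ((true, true), 2 * p.1, 2 * p.2 + 1)

lemma oddPyth_injective : Function.Injective oddPyth := by
  rintro ⟨a, b⟩ ⟨a', b'⟩ h
  simp only [oddPyth, pythParam, if_true, Prod.mk.injEq] at h
  obtain ⟨h1, -, h3⟩ := h
  have ha : (a : ℤ) ^ 2 = (a' : ℤ) ^ 2 := by linarith
  have hb : (2 * b + 1 : ℤ) ^ 2 = (2 * b' + 1 : ℤ) ^ 2 := by linarith
  rw [sq_eq_sq₀ (by positivity) (by positivity)] at ha hb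
  rw [Prod.mk.injEq]
  constructor <;> lia

lemma oddPyth_mem_pythSet {K : ℕ} {T : ℝ} (hT : 8 * (K : ℝ) ^ 2 ≤ √T) {p : ℕ × ℕ}
    (hp : p ∈ coprimeBox K) : oddPyth p ∈ pythSet T := by
  obtain ⟨a, b⟩ := p
  simp only [coprimeBox, pairBox, Finset.mem_filter, Finset.mem_product, Finset.mem_Icc,
    Finset.mem_range] at hp
  obtain ⟨⟨⟨ha1, haK⟩, hbK⟩, hcop⟩ := hp
  obtain ⟨m, hm⟩ : ∃ m : ℤ, m = 2 * a := ⟨_, rfl⟩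
  obtain ⟨n, hn⟩ : ∃ n : ℤ, n = 2 * b + 1 := ⟨_, rfl⟩
  have hmn : IsCoprime m n := by
    rw [hm, hn]
    exact_mod_cast Nat.isCoprime_iff_coprime.mpr hcop
  have hmK : m ≤ 2 * K := by lia
  have hnK : n ≤ 2 * K := by lia
  have hm0 : 0 < m := by lia
  have hn0 : 0 < n := by lia
  have hgcd : Int.gcd (m ^ 2 - n ^ 2) (2 * m * n) = 1 :=
    (PythagoreanTriple.coprime_classification.mpr ⟨m, n, Or.inl ⟨rfl, rfl⟩, Or.inl rfl,
      Int.isCoprime_iff_gcd_eq_one.mp hmn, Or.inl (by lia)⟩).2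
  have hodd : m ^ 2 - n ^ 2 ≠ 0 := by
    intro h
    have : m = n := by
      rw [← sq_eq_sq₀ hm0.le hn0.le]; linarith
    lia
  have hxy := Int.isCoprime_iff_gcd_eq_one.mpr hgcd
  have hz : (m ^ 2 - n ^ 2) ^ 2 + (2 * m * n) ^ 2 = (m ^ 2 + n ^ 2) ^ 2 := by ring
  have hxz : IsCoprime (m ^ 2 - n ^ 2) (m ^ 2 + n ^ 2) := by
    rw [← IsCoprime.pow_right_iff two_pos, ← hz, sq (m ^ 2 - n ^ 2),
      IsCoprime.mul_add_left_right_iff]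
    exact hxy.pow_right
  have hyz : IsCoprime (2 * m * n) (m ^ 2 + n ^ 2) := by
    rw [← IsCoprime.pow_right_iff two_pos, ← hz, sq (2 * m * n),
      IsCoprime.add_mul_left_right_iff]
    exact hxy.symm.pow_right
  have hT0 : 0 < T := by
    apply Real.sqrt_pos.mp
    have : (1 : ℝ) ≤ K := by exact_mod_cast ha1.trans haK
    nlinarith
  have hle : ∀ w : ℤ, |w| ≤ 8 * K ^ 2 → ((w ^ 2 : ℤ) : ℝ) ≤ T := by
    intro w hw
    have hw' : |(w : ℝ)| ≤ √T := le_trans (by exact_mod_cast hw) hT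
    push_cast
    rw [← Real.sq_sqrt hT0.le]
    exact sq_le_sq' (abs_le.mp hw').1 (abs_le.mp hw').2
  have hmem : ((m ^ 2 - n ^ 2, 2 * m * n, m ^ 2 + n ^ 2) : ℤ × ℤ × ℤ) ∈ pythSet T := by
    refine ⟨hodd, by positivity, by positivity, hgcd, Int.isCoprime_iff_gcd_eq_one.mp hxz,
      Int.isCoprime_iff_gcd_eq_one.mp hyz, hz, ?_⟩
    rw [Int.cast_max]
    exact max_le (hle _ (abs_le.mpr ⟨by nlinarith, by nlinarith⟩))
      (hle _ (abs_le.mpr ⟨by nlinarith, by nlinarith⟩))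
  simpa [oddPyth, pythParam, hm, hn] using hmem

lemma lt_pythCount (T : ℝ) (hT : 64 < T) : (1 / 65) * √T < (pythCount T : ℝ) := by
  set K := ⌊√(√T / 8)⌋₊
  have hs : 8 < √T := Real.lt_sqrt_of_sq_lt (by linarith)
  have h1 : 1 ≤ √(√T / 8) := Real.one_le_sqrt.mpr (by linarith)
  have hsq : √(√T / 8) ^ 2 = √T / 8 := Real.sq_sqrt (by positivity)
  have hKle : (K : ℝ) ≤ √(√T / 8) := Nat.floor_le (Real.sqrt_nonneg _)
  have hKlt : √(√T / 8) < K + 1 := Nat.lt_floor_add_one _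
  have hK1 : (1 : ℝ) ≤ K := by exact_mod_cast (Nat.le_floor (by simpa using h1) : 1 ≤ K)
  have hT8 : 8 * (K : ℝ) ^ 2 ≤ √T := by nlinarith
  have hcard : (coprimeBox K).card ≤ pythCount T := by
    rw [← Finset.card_image_of_injective _ oddPyth_injective, ← Set.ncard_coe_finset]
    refine Set.ncard_le_ncard ?_ (pythSet_finite T (by linarith))
    intro v hv
    obtain ⟨p, hp, rfl⟩ := Finset.mem_image.mp (Finset.mem_coe.mp hv)
    exact oddPyth_mem_pythSet hT8 hp
  have hcard' : ((coprimeBox K).card : ℝ) ≤ pythCount T := by exact_mod_cast hcard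
  have := le_card_coprimeBox K
  nlinarith

theorem pythCount_order_of_magnitude :
    ∃ c1 c2 c3 : ℝ, 0 < c1 ∧ 0 < c2 ∧ 0 < c3 ∧
      ∀ T : ℝ, c3 < T →
        c1 * Real.sqrt T < (pythCount T : ℝ) ∧ (pythCount T : ℝ) < c2 * Real.sqrt T := by
  exact ⟨1 / 65, 73, 64, by norm_num, by norm_num, by norm_num, fun T hT =>
    ⟨lt_pythCount T hT, pythCount_lt T (by linarith)⟩⟩
end

section
/- There exists an absolute constant C > 0 such that for every finite-index subgroup (full-rank sublattice) Λ of ℤ^2 and all positive real numbers R1, R2, the number of points (x1, x2) ∈ Λ with gcd(x1, x2) = 1, |x1| ≤ R1 and |x2| ≤ R2 is at most C * (R1 * R2 / det(Λ) + 1), where det(Λ) denotes the index [ℤ^2 : Λ] of Λ in ℤ^2. -/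
open Real

/-- The index of a sublattice of `ℤ × ℤ` divides the determinant of any two of its points. -/
lemma AddSubgroup.index_dvd_det {Λ : AddSubgroup (ℤ × ℤ)} {p q : ℤ × ℤ} (hp : p ∈ Λ)
    (hq : q ∈ Λ) : (Λ.index : ℤ) ∣ p.1 * q.2 - p.2 * q.1 := by
  by_cases h : p.1 * q.2 - p.2 * q.1 = 0
  · simp [h]
  set b := Module.Basis.finTwoProd ℤ
  set f := Matrix.toLin b b !![p.1, q.1; p.2, q.2] with hf
  have hfx (x : ℤ × ℤ) : f x = x.1 • p + x.2 • q := by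
    ext <;> simp [hf, b, Matrix.toLin_finTwoProd_apply] <;> ring
  have hdet : LinearMap.det f = p.1 * q.2 - p.2 * q.1 := by
    rw [hf, LinearMap.det_toLin, Matrix.det_fin_two_of]
    ring
  have hinj : Function.Injective f := by
    rw [← LinearMap.ker_eq_bot, LinearMap.ker_eq_bot']
    intro x hx
    rw [hfx] at hx
    have h1 : x.1 * p.1 + x.2 * q.1 = 0 := by simpa using congrArg Prod.fst hx
    have h2 : x.1 * p.2 + x.2 * q.2 = 0 := by simpa using congrArg Prod.snd hx
    ext
    · exact (mul_eq_zero.mp (by linear_combination q.2 * h1 - q.1 * h2 :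
        x.1 * (p.1 * q.2 - p.2 * q.1) = 0)).resolve_right h
    · exact (mul_eq_zero.mp (by linear_combination p.1 * h2 - p.2 * h1 :
        x.2 * (p.1 * q.2 - p.2 * q.1) = 0)).resolve_right h
  have hcard := Submodule.natAbs_det_equiv (LinearMap.range f) (LinearEquiv.ofInjective f hinj)
  have hcomp : (LinearMap.range f).subtype ∘ₗ
      ((LinearEquiv.ofInjective f hinj : (ℤ × ℤ) →+ LinearMap.range f).toIntLinearMap) = f := by
    ext <;> rfl
  have hle : (LinearMap.range f).toAddSubgroup ≤ Λ := by
    rintro _ ⟨x, rfl⟩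
    rw [hfx]
    exact Λ.add_mem (Λ.zsmul_mem hp _) (Λ.zsmul_mem hq _)
  have hdvd := AddSubgroup.index_dvd_of_le hle
  rw [← Int.natCast_dvd_natCast] at hdvd
  rw [← hdet, ← Int.dvd_natAbs]
  refine hdvd.trans (dvd_of_eq ?_)
  rw [← hcomp]
  exact congrArg _ hcard.symm

/-- Two proportional primitive points, the first with nonzero abscissa, whose abscissas are both
positive or both nonpositive, are equal. -/
lemma eq_of_gcd_eq_one_of_det_eq_zero {p q : ℤ × ℤ} (hp : Int.gcd p.1 p.2 = 1)
    (hq : Int.gcd q.1 q.2 = 1) (hp0 : p.1 ≠ 0) (hs : 0 < p.1 ↔ 0 < q.1)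
    (h : p.1 * q.2 - p.2 * q.1 = 0) : p = q := by
  have hpq : p.1 ∣ q.1 := (Int.isCoprime_iff_gcd_eq_one.mpr hp).dvd_of_dvd_mul_left
    ⟨q.2, by linear_combination -h⟩
  have hqp : q.1 ∣ p.1 := (Int.isCoprime_iff_gcd_eq_one.mpr hq).dvd_of_dvd_mul_left
    ⟨p.2, by linear_combination h⟩
  have h1 : p.1 = q.1 := by
    rcases Int.natAbs_eq_natAbs_iff.mp (Int.natAbs_eq_of_dvd_dvd hpq hqp) with h1 | h1 <;> omega
  have h2 : p.1 * (p.2 - q.2) = 0 := by rw [← h1] at h; linear_combination -h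
  exact Prod.ext h1 (sub_eq_zero.mp ((mul_eq_zero.mp h2).resolve_left hp0))

/-- A set of primitive points with pairwise determinants divisible by `d`, contained in the box
`|x| ≤ a`, `|y| ≤ b` and in the sector where the slope is at most `b / a` in absolute value,
is finite with at most `4 * (a * b / d + 1)` elements. -/
lemma finite_and_ncard_le_of_dvd_det {S : Set (ℤ × ℤ)} {d : ℕ} (hd : d ≠ 0) {a b : ℝ}
    (ha : 0 < a) (hb : 0 < b) (hgcd : ∀ p ∈ S, Int.gcd p.1 p.2 = 1)
    (hdet : ∀ p ∈ S, ∀ q ∈ S, (d : ℤ) ∣ p.1 * q.2 - p.2 * q.1)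
    (hbox : ∀ p ∈ S, |(p.1 : ℝ)| ≤ a) (hslope : ∀ p ∈ S, |(p.2 : ℝ)| * a ≤ b * |(p.1 : ℝ)|) :
    S.Finite ∧ (S.ncard : ℝ) ≤ 4 * (a * b / d + 1) := by
  have hd' : (0 : ℝ) < d := by positivity
  have hne : ∀ p ∈ S, p.1 ≠ 0 := by
    intro p hp h0
    have h1 := hslope p hp
    have h2 := hgcd p hp
    simp only [h0, Int.cast_zero, abs_zero, mul_zero] at h1
    have h3 : |(p.2 : ℝ)| = 0 := le_antisymm (nonpos_of_mul_nonpos_left h1 ha) (abs_nonneg _)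
    have h4 : p.2 = 0 := by simpa using h3
    simp [h0, h4] at h2
  set t : ℤ × ℤ → ℝ := fun p ↦ (p.2 : ℝ) / p.1 * (a ^ 2 / d) with ht
  set N : ℕ := ⌊a * b / d⌋₊ with hN
  set f : ℤ × ℤ → Prop × ℤ := fun p ↦ (0 < p.1, ⌊t p⌋) with hf
  set T : Finset (Prop × ℤ) := Finset.univ ×ˢ Finset.Icc (-(N : ℤ) - 1) N with hT
  have hmaps : ∀ p ∈ S, f p ∈ (T : Set (Prop × ℤ)) := by
    intro p hp
    have hp0 : (0 : ℝ) < |(p.1 : ℝ)| := by simpa using hne p hp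
    have habs : |t p| ≤ a * b / d := by
      rw [ht, abs_mul, abs_div, abs_of_pos (by positivity : 0 < a ^ 2 / (d : ℝ)),
        div_mul_div_comm, div_le_div_iff₀ (by positivity) hd']
      have := mul_le_mul_of_nonneg_right (hslope p hp) (by positivity : 0 ≤ a * d)
      linarith
    have hlt : a * b / d < N + 1 := Nat.lt_floor_add_one _
    obtain ⟨h1, h2⟩ := abs_le.mp habs
    have h3 : -(N : ℤ) - 1 ≤ ⌊t p⌋ := by
      rw [Int.le_floor]; push_cast; linarith
    have h4 : ⌊t p⌋ < N + 1 := by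
      rw [Int.floor_lt]; push_cast; linarith
    simp only [hT, hf, Finset.coe_product, Finset.coe_univ, Finset.coe_Icc, Set.mem_prod,
      Set.mem_univ, Set.mem_Icc, true_and]
    omega
  have hinj : Set.InjOn f S := by
    intro p hp q hq hpq
    obtain ⟨h1, h2⟩ := Prod.ext_iff.mp hpq
    refine eq_of_gcd_eq_one_of_det_eq_zero (hgcd p hp) (hgcd q hq) (hne p hp)
      (iff_of_eq h1) (Int.eq_zero_of_abs_lt_dvd (hdet p hp q hq) ?_)
    have hp0 : (p.1 : ℝ) ≠ 0 := by exact_mod_cast hne p hp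
    have hq0 : (q.1 : ℝ) ≠ 0 := by exact_mod_cast hne q hq
    have h3 := Int.abs_sub_lt_one_of_floor_eq_floor h2
    have h4 : ((p.1 : ℝ) * q.2 - p.2 * q.1) * a ^ 2 = -(p.1 * q.1 * d * (t p - t q)) := by
      simp only [ht]; field_simp; ring
    have h5 : |((p.1 : ℝ) * q.2 - p.2 * q.1)| * a ^ 2 < d * a ^ 2 := by
      rw [← abs_of_pos (by positivity : 0 < a ^ 2), ← abs_mul, h4, abs_neg, abs_mul, abs_mul,
        abs_mul, abs_of_pos hd', abs_of_pos (by positivity : 0 < a ^ 2)]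
      calc |(p.1 : ℝ)| * |(q.1 : ℝ)| * d * |t p - t q|
          < |(p.1 : ℝ)| * |(q.1 : ℝ)| * d * 1 := by gcongr
        _ ≤ a * a * d * 1 := by gcongr <;> [exact hbox p hp; exact hbox q hq]
        _ = d * a ^ 2 := by ring
    have h6 := lt_of_mul_lt_mul_right h5 (by positivity)
    exact_mod_cast h6
  have hfin : S.Finite := Set.Finite.of_injOn hmaps hinj T.finite_toSet
  refine ⟨hfin, ?_⟩
  have hcard := Set.ncard_le_ncard_of_injOn f hmaps hinj T.finite_toSet
  have hTcard : T.card = 2 * (2 * N + 2) := by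
    simp only [hT, Finset.card_product, Finset.card_univ, Fintype.card_prop, Int.card_Icc]
    omega
  rw [Set.ncard_coe_finset, hTcard] at hcard
  have hcard' : (S.ncard : ℝ) ≤ 2 * (2 * N + 2) := by exact_mod_cast hcard
  have hle : (N : ℝ) ≤ a * b / d := Nat.floor_le (by positivity)
  linarith

theorem primitive_lattice_points_in_box :
    ∃ C : ℝ, 0 < C ∧
      ∀ (Λ : AddSubgroup (ℤ × ℤ)), Λ.index ≠ 0 →
        ∀ R1 R2 : ℝ, 0 < R1 → 0 < R2 →
          (Set.ncard {p : ℤ × ℤ | p ∈ Λ ∧ Int.gcd p.1 p.2 = 1 ∧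
              ((|p.1| : ℤ) : ℝ) ≤ R1 ∧ ((|p.2| : ℤ) : ℝ) ≤ R2} : ℝ) ≤
            C * (R1 * R2 / (Λ.index : ℝ) + 1) := by
  refine ⟨8, by norm_num, fun Λ hΛ R1 R2 h1 h2 ↦ ?_⟩
  simp only [Int.cast_abs]
  set P := {p : ℤ × ℤ | p ∈ Λ ∧ Int.gcd p.1 p.2 = 1 ∧ |(p.1 : ℝ)| ≤ R1 ∧ |(p.2 : ℝ)| ≤ R2}
  set A := {p ∈ P | |(p.2 : ℝ)| * R1 ≤ R2 * |(p.1 : ℝ)|}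
  set B := {p ∈ P | |(p.1 : ℝ)| * R2 ≤ R1 * |(p.2 : ℝ)|}
  obtain ⟨hA, hAcard⟩ := finite_and_ncard_le_of_dvd_det (S := A) hΛ h1 h2
    (fun p hp ↦ hp.1.2.1) (fun p hp q hq ↦ AddSubgroup.index_dvd_det hp.1.1 hq.1.1)
    (fun p hp ↦ hp.1.2.2.1) (fun p hp ↦ hp.2)
  obtain ⟨hB, hBcard⟩ := finite_and_ncard_le_of_dvd_det (S := Prod.swap '' B) hΛ h2 h1
    (by rintro _ ⟨p, hp, rfl⟩; simpa [Int.gcd_comm] using hp.1.2.1)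
    (by
      rintro _ ⟨p, hp, rfl⟩ _ ⟨q, hq, rfl⟩
      convert (AddSubgroup.index_dvd_det hq.1.1 hp.1.1) using 1
      simp only [Prod.fst_swap, Prod.snd_swap]
      ring)
    (by rintro _ ⟨p, hp, rfl⟩; exact hp.1.2.2.2)
    (by rintro _ ⟨p, hp, rfl⟩; exact hp.2)
  rw [Set.ncard_image_of_injective _ Prod.swap_injective] at hBcard
  have hB' : B.Finite := hB.of_finite_image Prod.swap_injective.injOn
  have hsub : P ⊆ A ∪ B := by
    intro p hp
    rcases le_total (|(p.2 : ℝ)| * R1) (R2 * |(p.1 : ℝ)|) with h | h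
    · exact Or.inl ⟨hp, h⟩
    · exact Or.inr ⟨hp, by linarith⟩
  have hcard : P.ncard ≤ A.ncard + B.ncard :=
    (Set.ncard_le_ncard hsub (hA.union hB')).trans (Set.ncard_union_le A B)
  have hcard' : (P.ncard : ℝ) ≤ A.ncard + B.ncard := by exact_mod_cast hcard
  rw [mul_comm R2 R1] at hBcard
  linarith
end

section
/- There exists an absolute constant C > 0 with the following property: for all nonzero, pairwise coprime, squarefree integers x1, x2, x3 and all positive real numbers R1, R2, R3, the number of triples (y1, y2, y3) of integers with gcd(y1, y2, y3) = 1, x1*y1^2 + x2*y2^2 = x3*y3^2, and |y_i| ≤ R_i for i = 1, 2, 3, is at most C * d(|x1*x2*x3|) * ((R1*R2*R3 / |x1*x2*x3|)^(1/3) + 1). -/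
open Real

namespace DiagonalConic

/-- If `y` and `z` lie on the conic `a * X ^ 2 + b * Y ^ 2 + c * Z ^ 2 = 0` and are proportional
modulo `3 ^ k`, then they are orthogonal modulo `9 ^ k`. -/
lemma sq_dvd_bilin_of_proportional {k : ℕ} {a b c y₁ y₂ y₃ z₁ z₂ z₃ : ℤ}
    (hy : a * y₁ ^ 2 + b * y₂ ^ 2 + c * y₃ ^ 2 = 0)
    (hz : a * z₁ ^ 2 + b * z₂ ^ 2 + c * z₃ ^ 2 = 0)
    (hb : ¬ (3 : ℤ) ∣ b) (hy₁ : ¬ (3 : ℤ) ∣ y₁) (hy₂ : ¬ (3 : ℤ) ∣ y₂) (hz₁ : ¬ (3 : ℤ) ∣ z₁)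
    (h₁ : (3 : ℤ) ∣ y₁ - z₁) (h₂ : (3 : ℤ) ∣ y₂ - z₂)
    (h₃ : (3 : ℤ) ^ k ∣ y₃ * z₁ - z₃ * y₁) :
    ((3 : ℤ) ^ k) ^ 2 ∣ a * y₁ * z₁ + b * y₂ * z₂ + c * y₃ * z₃ := by
  have hp : Prime (3 : ℤ) := Int.prime_three
  have cop : ∀ {n : ℤ}, ¬ (3 : ℤ) ∣ n → IsCoprime ((3 : ℤ) ^ k) n := fun h =>
    IsCoprime.pow_left ((Prime.coprime_iff_not_dvd hp).2 h)
  have hsum : ¬ (3 : ℤ) ∣ y₂ * z₁ + z₂ * y₁ := by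
    intro h
    have : (3 : ℤ) ∣ 2 * (y₂ * y₁) := by
      have e : 2 * (y₂ * y₁) = (y₂ * z₁ + z₂ * y₁) + y₂ * (y₁ - z₁) + y₁ * (y₂ - z₂) := by ring
      rw [e]
      exact dvd_add (dvd_add h (h₁.mul_left _)) (h₂.mul_left _)
    rcases hp.dvd_or_dvd this with h | h
    · norm_num at h
    · exact (hp.dvd_or_dvd h).elim hy₂ hy₁
  have hdiff : (3 : ℤ) ^ k ∣ y₂ * z₁ - z₂ * y₁ := by
    have h : (3 : ℤ) ^ k ∣ b * ((y₂ * z₁ + z₂ * y₁) * (y₂ * z₁ - z₂ * y₁)) := by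
      have e : b * ((y₂ * z₁ + z₂ * y₁) * (y₂ * z₁ - z₂ * y₁)) =
          (-(c * (y₃ * z₁ + z₃ * y₁))) * (y₃ * z₁ - z₃ * y₁) := by
        linear_combination z₁ ^ 2 * hy - y₁ ^ 2 * hz
      rw [e]
      exact h₃.mul_left _
    exact (cop hsum).dvd_of_dvd_mul_left ((cop hb).dvd_of_dvd_mul_left h)
  obtain ⟨r, hr⟩ := hdiff
  obtain ⟨s, hs⟩ := h₃
  have hprod : ((3 : ℤ) ^ k) ^ 2 ∣
      2 * (z₁ * (y₁ * (a * y₁ * z₁ + b * y₂ * z₂ + c * y₃ * z₃))) := by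
    refine ⟨-(b * r ^ 2 + c * s ^ 2), ?_⟩
    linear_combination z₁ ^ 2 * hy + y₁ ^ 2 * hz -
      b * (y₂ * z₁ - z₂ * y₁ + 3 ^ k * r) * hr - c * (y₃ * z₁ - z₃ * y₁ + 3 ^ k * s) * hs
  have h2 : ¬ (3 : ℤ) ∣ 2 := by norm_num
  exact (cop hy₁).pow_left.dvd_of_dvd_mul_left
    ((cop hz₁).pow_left.dvd_of_dvd_mul_left ((cop h2).pow_left.dvd_of_dvd_mul_left hprod))

/-- A primitive point on a diagonal conic with squarefree first coefficient cannot have its last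
two coordinates divisible by the same prime. -/
lemma not_dvd_and_dvd {p a b c y₁ y₂ y₃ : ℤ} (hp : Prime p) (ha : Squarefree a)
    (hy : a * y₁ ^ 2 + b * y₂ ^ 2 + c * y₃ ^ 2 = 0)
    (hprim : ∃ u v w, u * y₁ + v * y₂ + w * y₃ = 1) (h₂ : p ∣ y₂) (h₃ : p ∣ y₃) : False := by
  obtain ⟨u, v, w, h⟩ := hprim
  have h₁ : ¬ p ∣ y₁ := by
    intro h₁
    refine hp.not_isUnit (isUnit_of_dvd_one ?_)
    rw [← h]
    exact dvd_add (dvd_add (h₁.mul_left _) (h₂.mul_left _)) (h₃.mul_left _)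
  obtain ⟨r, rfl⟩ := h₂
  obtain ⟨s, rfl⟩ := h₃
  have hd : p ^ 2 ∣ y₁ ^ 2 * a := ⟨-(b * r ^ 2 + c * s ^ 2), by linear_combination hy⟩
  have hpa := (((Prime.coprime_iff_not_dvd hp).2 h₁).pow (m := 2) (n := 2)).dvd_of_dvd_mul_left hd
  exact hp.not_isUnit (ha p (by rwa [← sq]))

lemma bilin_eq_zero_of_iff {K : Type*} [Field K] {b c y₂ y₃ z₂ z₃ w₂ w₃ : K}
    (hb : b ≠ 0) (hw₂ : w₂ ≠ 0)
    (hy : b * y₂ ^ 2 + c * y₃ ^ 2 = 0) (hz : b * z₂ ^ 2 + c * z₃ ^ 2 = 0)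
    (hw : b * w₂ ^ 2 + c * w₃ ^ 2 = 0)
    (h : b * y₂ * w₂ + c * y₃ * w₃ = 0 ↔ b * z₂ * w₂ + c * z₃ * w₃ = 0) :
    b * y₂ * z₂ + c * y₃ * z₃ = 0 := by
  have hne : b * w₂ ^ 2 ≠ 0 := mul_ne_zero hb (pow_ne_zero _ hw₂)
  refine (mul_eq_zero.1 ?_).resolve_right hne
  by_cases h1 : b * y₂ * w₂ + c * y₃ * w₃ = 0
  · have h2 := h.1 h1
    linear_combination b * z₂ * w₂ * h1 - c * y₃ * w₃ * h2 + c * y₃ * z₃ * hw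
  · have h2 : ¬ b * z₂ * w₂ + c * z₃ * w₃ = 0 := fun h' => h1 (h.2 h')
    have h1' : b * y₂ * w₂ - c * y₃ * w₃ = 0 := by
      refine (mul_eq_zero.1 ?_).resolve_left h1
      linear_combination b * w₂ ^ 2 * hy - c * y₃ ^ 2 * hw
    have h2' : b * z₂ * w₂ - c * z₃ * w₃ = 0 := by
      refine (mul_eq_zero.1 ?_).resolve_left h2
      linear_combination b * w₂ ^ 2 * hz - c * z₃ ^ 2 * hw
    linear_combination b * z₂ * w₂ * h1' + c * y₃ * w₃ * h2' + c * y₃ * z₃ * hw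

/-- Modulo a prime dividing the first coefficient the conic splits into two lines, and two points
lying on the same line are orthogonal. -/
lemma prime_dvd_bilin {p : ℕ} (hp : p.Prime) {a b c y₁ y₂ y₃ z₁ z₂ z₃ w₁ w₂ w₃ : ℤ}
    (ha : Squarefree a) (hpa : (p : ℤ) ∣ a) (hpb : ¬ (p : ℤ) ∣ b) (hpc : ¬ (p : ℤ) ∣ c)
    (hy : a * y₁ ^ 2 + b * y₂ ^ 2 + c * y₃ ^ 2 = 0)
    (hz : a * z₁ ^ 2 + b * z₂ ^ 2 + c * z₃ ^ 2 = 0)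
    (hw : a * w₁ ^ 2 + b * w₂ ^ 2 + c * w₃ ^ 2 = 0)
    (hprim : ∃ u v w, u * w₁ + v * w₂ + w * w₃ = 1)
    (h : (p : ℤ) ∣ a * y₁ * w₁ + b * y₂ * w₂ + c * y₃ * w₃ ↔
      (p : ℤ) ∣ a * z₁ * w₁ + b * z₂ * w₂ + c * z₃ * w₃) :
    (p : ℤ) ∣ a * y₁ * z₁ + b * y₂ * z₂ + c * y₃ * z₃ := by
  have : Fact p.Prime := ⟨hp⟩
  have hpZ : Prime (p : ℤ) := Nat.prime_iff_prime_int.1 hp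
  have hw₂ : ¬ (p : ℤ) ∣ w₂ := by
    intro h₂
    have h₃ : (p : ℤ) ∣ c * w₃ ^ 2 := by
      have e : c * w₃ ^ 2 = -(a * w₁ ^ 2 + b * w₂ ^ 2) := by linear_combination hw
      rw [e]
      exact (dvd_add (hpa.mul_right _) ((dvd_pow h₂ two_ne_zero).mul_left _)).neg_right
    exact not_dvd_and_dvd hpZ ha hw hprim h₂
      (hpZ.dvd_of_dvd_pow ((hpZ.dvd_or_dvd h₃).resolve_left hpc))
  simp only [← ZMod.intCast_zmod_eq_zero_iff_dvd] at *
  have hy' := congrArg (Int.cast : ℤ → ZMod p) hy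
  have hz' := congrArg (Int.cast : ℤ → ZMod p) hz
  have hw' := congrArg (Int.cast : ℤ → ZMod p) hw
  push_cast at *
  simp only [hpa, zero_mul, zero_add] at *
  exact bilin_eq_zero_of_iff hpb hw₂ hy' hz' hw' h

/-- Two proportional primitive vectors agree up to sign. -/
lemma eq_or_eq_neg_of_cross_eq_zero {y z : Fin 3 → ℤ}
    (hy : ∃ u v w, u * y 0 + v * y 1 + w * y 2 = 1)
    (hz : ∃ u v w, u * z 0 + v * z 1 + w * z 2 = 1)
    (h₀ : y 1 * z 2 = y 2 * z 1) (h₁ : y 0 * z 2 = y 2 * z 0) (h₂ : y 0 * z 1 = y 1 * z 0) :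
    z = y ∨ z = -y := by
  obtain ⟨u, v, w, hy⟩ := hy
  obtain ⟨u', v', w', hz⟩ := hz
  have e₀ : z 0 = (u * z 0 + v * z 1 + w * z 2) * y 0 := by
    linear_combination -z 0 * hy - v * h₂ - w * h₁
  have e₁ : z 1 = (u * z 0 + v * z 1 + w * z 2) * y 1 := by
    linear_combination -z 1 * hy + u * h₂ - w * h₀
  have e₂ : z 2 = (u * z 0 + v * z 1 + w * z 2) * y 2 := by
    linear_combination -z 2 * hy + u * h₁ + v * h₀
  generalize u * z 0 + v * z 1 + w * z 2 = s at e₀ e₁ e₂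
  have hs : IsUnit s := by
    refine isUnit_of_dvd_one ⟨u' * y 0 + v' * y 1 + w' * y 2, ?_⟩
    rw [← hz, e₀, e₁, e₂]
    ring
  rcases Int.isUnit_iff.1 hs with rfl | rfl
  · left
    funext i
    fin_cases i <;> simp_all
  · right
    funext i
    fin_cases i <;> simp_all

/-- The bilinear form attached to the diagonal quadratic form with coefficients `a`. -/
def bilin (a y z : Fin 3 → ℤ) : ℤ := a 0 * y 0 * z 0 + a 1 * y 1 * z 1 + a 2 * y 2 * z 2

/-- Primitive integral points on the conic `∑ i, a i * y i ^ 2 = 0`. -/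
structure IsPrimitivePoint (a y : Fin 3 → ℤ) : Prop where
  isotropic : a 0 * y 0 ^ 2 + a 1 * y 1 ^ 2 + a 2 * y 2 ^ 2 = 0
  primitive : ∃ u v w, u * y 0 + v * y 1 + w * y 2 = 1

/-- Nonzero, squarefree and pairwise coprime coefficients. -/
structure IsReduced (a : Fin 3 → ℤ) : Prop where
  ne_zero : ∀ i, a i ≠ 0
  squarefree : ∀ i, Squarefree (a i)
  coprime : ∀ i j, i ≠ j → IsCoprime (a i) (a j)

/-- The determinant of three vectors in `ℤ ^ 3`. -/
def det3 (y z w : Fin 3 → ℤ) : ℤ :=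
  y 0 * (z 1 * w 2 - z 2 * w 1) - y 1 * (z 0 * w 2 - z 2 * w 0) + y 2 * (z 0 * w 1 - z 1 * w 0)

variable {a y z w : Fin 3 → ℤ}

lemma eq_or_eq_neg_of_bilin_eq_zero (ha : IsReduced a) (hy : IsPrimitivePoint a y)
    (hz : IsPrimitivePoint a z) (h : bilin a y z = 0) : z = y ∨ z = -y := by
  have hQy := hy.isotropic
  have hQz := hz.isotropic
  unfold bilin at h
  have key : ∀ {s t m : ℤ}, s ≠ 0 → t ≠ 0 → s * t * m ^ 2 = 0 → m = 0 := fun hs ht hm =>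
    pow_eq_zero_iff two_ne_zero |>.1 ((mul_eq_zero.1 hm).resolve_left (mul_ne_zero hs ht))
  refine eq_or_eq_neg_of_cross_eq_zero hy.primitive hz.primitive ?_ ?_ ?_
  · refine sub_eq_zero.1 (key (ha.ne_zero 1) (ha.ne_zero 2) ?_)
    linear_combination (a 1 * z 1 ^ 2 + a 2 * z 2 ^ 2) * hQy - a 0 * y 0 ^ 2 * hQz -
      (a 1 * y 1 * z 1 + a 2 * y 2 * z 2 - a 0 * y 0 * z 0) * h
  · refine sub_eq_zero.1 (key (ha.ne_zero 0) (ha.ne_zero 2) ?_)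
    linear_combination (a 0 * z 0 ^ 2 + a 2 * z 2 ^ 2) * hQy - a 1 * y 1 ^ 2 * hQz -
      (a 0 * y 0 * z 0 + a 2 * y 2 * z 2 - a 1 * y 1 * z 1) * h
  · refine sub_eq_zero.1 (key (ha.ne_zero 0) (ha.ne_zero 1) ?_)
    linear_combination (a 0 * z 0 ^ 2 + a 1 * z 1 ^ 2) * hQy - a 2 * y 2 ^ 2 * hQz -
      (a 0 * y 0 * z 0 + a 1 * y 1 * z 1 - a 2 * y 2 * z 2) * h

/-- The Gram determinant of three isotropic vectors. -/
lemma gram_det (hy : IsPrimitivePoint a y) (hz : IsPrimitivePoint a z)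
    (hw : IsPrimitivePoint a w) :
    det3 y z w ^ 2 * (a 0 * a 1 * a 2) = 2 * bilin a y z * bilin a y w * bilin a z w := by
  have hQy := hy.isotropic
  have hQz := hz.isotropic
  have hQw := hw.isotropic
  have e : det3 y z w ^ 2 * (a 0 * a 1 * a 2) =
      2 * bilin a y z * bilin a y w * bilin a z w
      + (a 0 * y 0 ^ 2 + a 1 * y 1 ^ 2 + a 2 * y 2 ^ 2) *
        (a 0 * z 0 ^ 2 + a 1 * z 1 ^ 2 + a 2 * z 2 ^ 2) *
        (a 0 * w 0 ^ 2 + a 1 * w 1 ^ 2 + a 2 * w 2 ^ 2)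
      - (a 0 * y 0 ^ 2 + a 1 * y 1 ^ 2 + a 2 * y 2 ^ 2) * bilin a z w ^ 2
      - (a 0 * z 0 ^ 2 + a 1 * z 1 ^ 2 + a 2 * z 2 ^ 2) * bilin a y w ^ 2
      - (a 0 * w 0 ^ 2 + a 1 * w 1 ^ 2 + a 2 * w 2 ^ 2) * bilin a y z ^ 2 := by
    unfold det3 bilin
    ring
  rw [e, hQy, hQz, hQw]
  ring

lemma IsReduced.squarefree_prod (ha : IsReduced a) : Squarefree (a 0 * a 1 * a 2) := by
  have h01 := ha.coprime 0 1 (by decide)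
  have h02 := ha.coprime 0 2 (by decide)
  have h12 := ha.coprime 1 2 (by decide)
  exact (squarefree_mul_iff.2 ⟨(h02.mul_left h12).isRelPrime,
    squarefree_mul_iff.2 ⟨h01.isRelPrime, ha.squarefree 0, ha.squarefree 1⟩, ha.squarefree 2⟩)

lemma IsReduced.not_dvd (ha : IsReduced a) {p : ℤ} (hp : Prime p) {i j : Fin 3} (hij : i ≠ j)
    (h : p ∣ a i) : ¬ p ∣ a j :=
  fun h' => hp.not_isUnit ((ha.coprime i j hij).isUnit_of_dvd' h h')

/-- Points with the same greatest common divisor `gcd (Δ, B(·, w))` are orthogonal modulo the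
discriminant `Δ`. -/
lemma discr_dvd_bilin (ha : IsReduced a) (hy : IsPrimitivePoint a y) (hz : IsPrimitivePoint a z)
    (hw : IsPrimitivePoint a w)
    (h : Int.gcd (a 0 * a 1 * a 2) (bilin a y w) = Int.gcd (a 0 * a 1 * a 2) (bilin a z w)) :
    a 0 * a 1 * a 2 ∣ bilin a y z := by
  have hsq : Squarefree (a 0 * a 1 * a 2).natAbs := Int.squarefree_natAbs.2 ha.squarefree_prod
  rw [← Int.natAbs_dvd, Int.natCast_dvd, ← Nat.prod_primeFactors_of_squarefree hsq]
  refine Finset.prod_primes_dvd _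
    (fun p hp => (Nat.prime_of_mem_primeFactors hp).prime) fun p hp => Int.natCast_dvd.1 ?_
  have hpp := Nat.prime_of_mem_primeFactors hp
  have hpZ := Nat.prime_iff_prime_int.1 hpp
  have hpD : (p : ℤ) ∣ a 0 * a 1 * a 2 := Int.natCast_dvd.2 (Nat.dvd_of_mem_primeFactors hp)
  have hiff : (p : ℤ) ∣ bilin a y w ↔ (p : ℤ) ∣ bilin a z w := by
    have e : ∀ n : ℤ, (p : ℤ) ∣ n ↔ (p : ℤ) ∣ (Int.gcd (a 0 * a 1 * a 2) n : ℤ) := fun n =>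
      ⟨fun hn => Int.dvd_coe_gcd hpD hn, fun hn => hn.trans (Int.gcd_dvd_right ..)⟩
    rw [e, h, ← e]
  have hQy := hy.isotropic
  have hQz := hz.isotropic
  have hQw := hw.isotropic
  obtain ⟨u, v, t, hwp⟩ := hw.primitive
  unfold bilin at hiff ⊢
  rcases hpZ.dvd_or_dvd hpD with h' | h2
  · rcases hpZ.dvd_or_dvd h' with h0 | h1
    · exact prime_dvd_bilin hpp (ha.squarefree 0) h0 (ha.not_dvd hpZ (by decide) h0)
        (ha.not_dvd hpZ (by decide) h0) hQy hQz hQw ⟨u, v, t, hwp⟩ hiff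
    · have := prime_dvd_bilin (y₁ := y 1) (y₂ := y 0) (y₃ := y 2) (z₁ := z 1) (z₂ := z 0)
        (z₃ := z 2) (w₁ := w 1) (w₂ := w 0) (w₃ := w 2) (b := a 0) (c := a 2) hpp
        (ha.squarefree 1) h1 (ha.not_dvd hpZ (by decide) h1) (ha.not_dvd hpZ (by decide) h1)
        (by linarith) (by linarith) (by linarith) ⟨v, u, t, by linarith⟩
        (by convert hiff using 2 <;> ring)
      convert this using 1
      ring
  · have := prime_dvd_bilin (y₁ := y 2) (y₂ := y 0) (y₃ := y 1) (z₁ := z 2) (z₂ := z 0)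
        (z₃ := z 1) (w₁ := w 2) (w₂ := w 0) (w₃ := w 1) (b := a 0) (c := a 1) hpp
        (ha.squarefree 2) h2 (ha.not_dvd hpZ (by decide) h2) (ha.not_dvd hpZ (by decide) h2)
        (by linarith) (by linarith) (by linarith) ⟨t, u, v, by linarith⟩
        (by convert hiff using 2 <;> ring)
    convert this using 1
    ring

/-- Some two coordinates of a primitive point are units modulo `3`, and one of the two
corresponding coefficients is as well. -/
lemma exists_pivots (ha : IsReduced a) (hy : IsPrimitivePoint a y) :
    ∃ i j : Fin 3, i ≠ j ∧ ¬ (3 : ℤ) ∣ y i ∧ ¬ (3 : ℤ) ∣ y j ∧ ¬ (3 : ℤ) ∣ a j := by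
  have hp : Prime (3 : ℤ) := Int.prime_three
  have hQ := hy.isotropic
  obtain ⟨u, v, t, hyp⟩ := hy.primitive
  have h12 : (3 : ℤ) ∣ y 1 → ¬ (3 : ℤ) ∣ y 2 :=
    fun h h' => not_dvd_and_dvd hp (ha.squarefree 0) hQ ⟨u, v, t, hyp⟩ h h'
  have h02 : (3 : ℤ) ∣ y 0 → ¬ (3 : ℤ) ∣ y 2 :=
    fun h h' => not_dvd_and_dvd (b := a 0) (c := a 2) (y₁ := y 1) hp (ha.squarefree 1)
      (by linarith) ⟨v, u, t, by linarith⟩ h h'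
  have h01 : (3 : ℤ) ∣ y 0 → ¬ (3 : ℤ) ∣ y 1 :=
    fun h h' => not_dvd_and_dvd (b := a 0) (c := a 1) (y₁ := y 2) hp (ha.squarefree 2)
      (by linarith) ⟨t, u, v, by linarith⟩ h h'
  have key : ∀ i j : Fin 3, i ≠ j → ¬ (3 : ℤ) ∣ y i → ¬ (3 : ℤ) ∣ y j →
      ∃ i j : Fin 3, i ≠ j ∧ ¬ (3 : ℤ) ∣ y i ∧ ¬ (3 : ℤ) ∣ y j ∧ ¬ (3 : ℤ) ∣ a j := by
    intro i j hij hi hj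
    by_cases h : (3 : ℤ) ∣ a j
    · exact ⟨j, i, hij.symm, hj, hi, ha.not_dvd hp hij.symm h⟩
    · exact ⟨i, j, hij, hi, hj, h⟩
  by_cases h0 : (3 : ℤ) ∣ y 0
  · exact key 1 2 (by decide) (h01 h0) (h02 h0)
  · by_cases h1 : (3 : ℤ) ∣ y 1
    · exact key 0 2 (by decide) h0 (h12 h1)
    · exact key 0 1 (by decide) h0 h1

/-- The classification of primitive points modulo `3 ^ k`: for distinct `i`, `j` the remaining
index is `-(i + j)`. -/
def HasCode (a : Fin 3 → ℤ) (k : ℕ) (y : Fin 3 → ℤ)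
    (t : Fin 3 × Fin 3 × ZMod (3 ^ k) × ZMod 3 × ZMod 3) : Prop :=
  t.1 ≠ t.2.1 ∧ ¬ (3 : ℤ) ∣ y t.1 ∧ ¬ (3 : ℤ) ∣ y t.2.1 ∧ ¬ (3 : ℤ) ∣ a t.2.1 ∧
    (y (-(t.1 + t.2.1)) : ZMod (3 ^ k)) * (y t.1 : ZMod (3 ^ k))⁻¹ = t.2.2.1 ∧
    (y t.1 : ZMod 3) = t.2.2.2.1 ∧ (y t.2.1 : ZMod 3) = t.2.2.2.2

lemma exists_hasCode (ha : IsReduced a) (hy : IsPrimitivePoint a y) (k : ℕ) :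
    ∃ t, HasCode a k y t := by
  obtain ⟨i, j, hij, hi, hj, hja⟩ := exists_pivots ha hy
  exact ⟨⟨i, j, y (-(i + j)) * (y i : ZMod (3 ^ k))⁻¹, y i, y j⟩, hij, hi, hj, hja, rfl, rfl, rfl⟩

lemma sq_dvd_bilin_of_hasCode (hy : IsPrimitivePoint a y) (hz : IsPrimitivePoint a z) {k : ℕ}
    {t : Fin 3 × Fin 3 × ZMod (3 ^ k) × ZMod 3 × ZMod 3} (hyt : HasCode a k y t)
    (hzt : HasCode a k z t) : ((3 : ℤ) ^ k) ^ 2 ∣ bilin a y z := by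
  obtain ⟨i, j, s, r₁, r₂⟩ := t
  obtain ⟨hij, hyi, hyj, hja, hys, hyr₁, hyr₂⟩ := hyt
  obtain ⟨-, hzi, -, -, hzs, hzr₁, hzr₂⟩ := hzt
  dsimp only at *
  have h₁ : (3 : ℤ) ∣ y i - z i :=
    (ZMod.intCast_eq_intCast_iff_dvd_sub (z i) (y i) 3).1 (hzr₁.trans hyr₁.symm)
  have h₂ : (3 : ℤ) ∣ y j - z j :=
    (ZMod.intCast_eq_intCast_iff_dvd_sub (z j) (y j) 3).1 (hzr₂.trans hyr₂.symm)
  have unit : ∀ n : ℤ, ¬ (3 : ℤ) ∣ n → (n : ZMod (3 ^ k)) * (n : ZMod (3 ^ k))⁻¹ = 1 := by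
    intro n hn
    refine ZMod.mul_inv_of_unit _ ((ZMod.coe_int_isUnit_iff_isCoprime n (3 ^ k)).2 ?_)
    push_cast
    exact ((Prime.coprime_iff_not_dvd Int.prime_three).2 hn).pow_left
  have h₃ : (3 : ℤ) ^ k ∣ y (-(i + j)) * z i - z (-(i + j)) * y i := by
    have h : ((z (-(i + j)) * y i : ℤ) : ZMod (3 ^ k)) = (y (-(i + j)) * z i : ℤ) := by
      push_cast
      have hyu := unit _ hyi
      have hzu := unit _ hzi
      linear_combination (y i * z i : ZMod (3 ^ k)) * (hzs - hys) -
        (z (-(i + j)) * y i : ZMod (3 ^ k)) * hzu + (y (-(i + j)) * z i : ZMod (3 ^ k)) * hyu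
    have := (ZMod.intCast_eq_intCast_iff_dvd_sub _ _ _).1 h
    push_cast at this
    exact this
  have perm : ∀ f : Fin 3 → ℤ, f i + f j + f (-(i + j)) = f 0 + f 1 + f 2 := by
    intro f
    fin_cases i <;> fin_cases j <;> first | exact absurd rfl hij | skip
    · change f 0 + f 1 + f 2 = _
      ring
    · change f 0 + f 2 + f 1 = _
      ring
    · change f 1 + f 0 + f 2 = _
      ring
    · change f 1 + f 2 + f 0 = _
      ring
    · change f 2 + f 0 + f 1 = _
      ring
    · change f 2 + f 1 + f 0 = _
      ring
  have := sq_dvd_bilin_of_proportional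
    ((perm fun l => a l * y l ^ 2).trans hy.isotropic)
    ((perm fun l => a l * z l ^ 2).trans hz.isotropic) hja hyi hyj hzi h₁ h₂ h₃
  rwa [perm fun l => a l * y l * z l] at this

lemma det3_dvd (ha : IsReduced a) (hy : IsPrimitivePoint a y) (hz : IsPrimitivePoint a z)
    (hw : IsPrimitivePoint a w) {k : ℕ}
    (hyz : a 0 * a 1 * a 2 ∣ bilin a y z) (hyw : a 0 * a 1 * a 2 ∣ bilin a y w)
    (hzw : a 0 * a 1 * a 2 ∣ bilin a z w)
    (hyz' : ((3 : ℤ) ^ k) ^ 2 ∣ bilin a y z) (hyw' : ((3 : ℤ) ^ k) ^ 2 ∣ bilin a y w)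
    (hzw' : ((3 : ℤ) ^ k) ^ 2 ∣ bilin a z w) :
    a 0 * a 1 * a 2 * (3 ^ k) ^ 3 ∣ 9 * det3 y z w := by
  have hgram := gram_det hy hz hw
  have hsq := ha.squarefree_prod
  generalize a 0 * a 1 * a 2 = D at *
  have hp : Prime (3 : ℤ) := Int.prime_three
  have hD : D ≠ 0 := hsq.ne_zero
  obtain ⟨e, E, rfl, he, hE⟩ : ∃ e E : ℤ, D = e * E ∧ e ∣ 3 ∧ ¬ (3 : ℤ) ∣ E := by
    by_cases h : (3 : ℤ) ∣ D
    · obtain ⟨E, rfl⟩ := h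
      refine ⟨3, E, rfl, dvd_rfl, fun h => hp.not_isUnit (hsq 3 (mul_dvd_mul_left 3 h))⟩
    · exact ⟨1, D, (one_mul D).symm, one_dvd _, h⟩
  have cop : IsCoprime E (((3 : ℤ) ^ k) ^ 2) :=
    (((Prime.coprime_iff_not_dvd hp).2 hE).pow_left.pow_left).symm
  obtain ⟨r, hr⟩ := cop.mul_dvd ((dvd_mul_left E e).trans hyz) hyz'
  obtain ⟨s, hs⟩ := cop.mul_dvd ((dvd_mul_left E e).trans hyw) hyw'
  obtain ⟨t, ht⟩ := cop.mul_dvd ((dvd_mul_left E e).trans hzw) hzw'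
  obtain ⟨f, hf⟩ := he
  have hE0 : E ≠ 0 := right_ne_zero_of_mul hD
  have h1 : (E * (3 ^ k) ^ 3) ^ 2 ∣ (3 * det3 y z w) ^ 2 := by
    refine ⟨3 * f * 2 * r * s * t, mul_right_cancel₀ hE0 ?_⟩
    rw [hr, hs, ht] at hgram
    linear_combination 3 * f * hgram + 3 * det3 y z w ^ 2 * E * hf
  have h2 := (Int.pow_dvd_pow_iff two_ne_zero).1 h1
  obtain ⟨g, hg⟩ := h2
  refine ⟨f * g, ?_⟩
  linear_combination 3 * hg + E * (3 ^ k) ^ 3 * g * hf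

lemma abs_det3_le {R : Fin 3 → ℝ} (hy : ∀ i, |(y i : ℝ)| ≤ R i) (hz : ∀ i, |(z i : ℝ)| ≤ R i)
    (hw : ∀ i, |(w i : ℝ)| ≤ R i) : |(det3 y z w : ℝ)| ≤ 6 * (R 0 * R 1 * R 2) := by
  have key : ∀ {p q r P Q S : ℝ}, |p| ≤ P → |q| ≤ Q → |r| ≤ S → |p * q * r| ≤ P * Q * S := by
    intro p q r P Q S hp hq hr
    rw [abs_mul, abs_mul]
    have := (abs_nonneg p).trans hp
    have := (abs_nonneg q).trans hq
    gcongr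
  have h1 := abs_le.1 (key (hy 0) (hz 1) (hw 2))
  have h2 := abs_le.1 (key (hy 0) (hw 1) (hz 2))
  have h3 := abs_le.1 (key (hz 0) (hy 1) (hw 2))
  have h4 := abs_le.1 (key (hw 0) (hy 1) (hz 2))
  have h5 := abs_le.1 (key (hz 0) (hw 1) (hy 2))
  have h6 := abs_le.1 (key (hw 0) (hz 1) (hy 2))
  unfold det3
  push_cast
  rw [abs_le]
  constructor <;> linarith [h1.1, h1.2, h2.1, h2.2, h3.1, h3.2, h4.1, h4.2, h5.1, h5.2, h6.1, h6.2]

/-- If among any three elements of a finite set two agree up to sign, it has at most four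
elements. -/
lemma card_le_four {V : Type*} [DecidableEq V] [InvolutiveNeg V] (F : Finset V)
    (h : ∀ y ∈ F, ∀ z ∈ F, ∀ w ∈ F, (z = y ∨ z = -y) ∨ (w = y ∨ w = -y) ∨ (w = z ∨ w = -z)) :
    F.card ≤ 4 := by
  have aux : ∀ y z : V, F ⊆ {y, -y, z, -z} → F.card ≤ 4 := fun y z hF =>
    (Finset.card_le_card hF).trans Finset.card_le_four
  rcases F.eq_empty_or_nonempty with rfl | ⟨y, hy⟩
  · simp
  by_cases hall : ∀ z ∈ F, z = y ∨ z = -y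
  · refine aux y y fun z hz => ?_
    rcases hall z hz with h | h <;> simp [h]
  · push Not at hall
    obtain ⟨z, hz, hzy⟩ := hall
    refine aux y z fun w hw => ?_
    rcases h y hy z hz w hw with (h | h) | (h | h) | (h | h)
    · exact absurd h hzy.1
    · exact absurd h hzy.2
    all_goals simp [h]

lemma card_le_of_lt (ha : IsReduced a) {R : Fin 3 → ℝ} {k : ℕ}
    (hk : 54 * (R 0 * R 1 * R 2) < |((a 0 * a 1 * a 2 : ℤ) : ℝ)| * (3 ^ k) ^ 3)
    (F : Finset (Fin 3 → ℤ)) (hF : ∀ y ∈ F, IsPrimitivePoint a y)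
    (hR : ∀ y ∈ F, ∀ i, |(y i : ℝ)| ≤ R i) :
    F.card ≤ 324 * 3 ^ k * (a 0 * a 1 * a 2).natAbs.divisors.card := by
  classical
  rcases F.eq_empty_or_nonempty with rfl | ⟨p, hp⟩
  · simp
  have hD : a 0 * a 1 * a 2 ≠ 0 := ha.squarefree_prod.ne_zero
  have : NeZero (3 ^ k) := ⟨by positivity⟩
  choose! code hcode using fun y (hy : y ∈ F) => exists_hasCode ha (hF y hy) k
  let φ : (Fin 3 → ℤ) → (Fin 3 × Fin 3 × ZMod (3 ^ k) × ZMod 3 × ZMod 3) × ℕ :=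
    fun y => (code y, Int.gcd (a 0 * a 1 * a 2) (bilin a y p))
  let T : Finset ((Fin 3 × Fin 3 × ZMod (3 ^ k) × ZMod 3 × ZMod 3) × ℕ) :=
    Finset.univ ×ˢ (a 0 * a 1 * a 2).natAbs.divisors
  have hφ : ∀ y ∈ F, φ y ∈ T := by
    intro y _
    simp only [T, φ, Finset.mem_product, Finset.mem_univ, true_and, Nat.mem_divisors]
    exact ⟨Int.natCast_dvd.1 (Int.gcd_dvd_left ..), Int.natAbs_ne_zero.2 hD⟩
  have hT : T.card = 81 * 3 ^ k * (a 0 * a 1 * a 2).natAbs.divisors.card := by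
    simp only [T, Finset.card_product, Finset.card_univ, Fintype.card_prod, Fintype.card_fin,
      ZMod.card]
    ring
  have horth : ∀ y ∈ F, ∀ z ∈ F, φ y = φ z →
      a 0 * a 1 * a 2 ∣ bilin a y z ∧ ((3 : ℤ) ^ k) ^ 2 ∣ bilin a y z := by
    intro y hy z hz h
    obtain ⟨hc, hg⟩ := Prod.mk.inj h
    exact ⟨discr_dvd_bilin ha (hF y hy) (hF z hz) (hF p hp) hg,
      sq_dvd_bilin_of_hasCode (hF y hy) (hF z hz) (hcode y hy) (hc ▸ hcode z hz)⟩
  have hfib : ∀ t ∈ T, (F.filter fun y => φ y = t).card ≤ 4 := by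
    intro t _
    refine card_le_four _ fun y hy z hz w hw => ?_
    rw [Finset.mem_filter] at hy hz hw
    obtain ⟨hy, rfl⟩ := hy
    obtain ⟨hz, hzy⟩ := hz
    obtain ⟨hw, hwy⟩ := hw
    have hyz := horth y hy z hz hzy.symm
    have hyw := horth y hy w hw hwy.symm
    have hzw := horth z hz w hw (hzy.trans hwy.symm)
    have hdvd := det3_dvd ha (hF y hy) (hF z hz) (hF w hw) hyz.1 hyw.1 hzw.1 hyz.2 hyw.2 hzw.2
    have hlt : |9 * det3 y z w| < |a 0 * a 1 * a 2 * (3 ^ k) ^ 3| := by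
      have h6 := abs_det3_le (hR y hy) (hR z hz) (hR w hw)
      have : |(9 * det3 y z w : ℝ)| < |((a 0 * a 1 * a 2 : ℤ) : ℝ) * (3 ^ k) ^ 3| := by
        rw [abs_mul, abs_mul, abs_of_pos (show (0 : ℝ) < (3 ^ k) ^ 3 by positivity),
          abs_of_pos (show (0 : ℝ) < 9 by norm_num)]
        linarith
      exact_mod_cast this
    have hdet : det3 y z w = 0 := by
      have := Int.eq_zero_of_abs_lt_dvd ((abs_dvd _ _).2 hdvd) hlt
      omega
    have hgram := gram_det (hF y hy) (hF z hz) (hF w hw)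
    rw [hdet] at hgram
    have hzero : bilin a y z * bilin a y w * bilin a z w = 0 := by linarith
    rcases mul_eq_zero.1 hzero with h | h
    · rcases mul_eq_zero.1 h with h | h
      · exact Or.inl (eq_or_eq_neg_of_bilin_eq_zero ha (hF y hy) (hF z hz) h)
      · exact Or.inr (Or.inl (eq_or_eq_neg_of_bilin_eq_zero ha (hF y hy) (hF w hw) h))
    · exact Or.inr (Or.inr (eq_or_eq_neg_of_bilin_eq_zero ha (hF z hz) (hF w hw) h))
  calc F.card ≤ 4 * T.card := Finset.card_le_mul_card_image_of_maps_to hφ 4 hfib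
    _ = _ := by rw [hT]; ring

lemma exists_three_pow {X : ℝ} (hX : 0 ≤ X) :
    ∃ k : ℕ, 54 * X < (3 ^ k) ^ 3 ∧ (3 : ℝ) ^ k ≤ 12 * (X ^ ((1 : ℝ) / 3) + 1) := by
  have hr : 0 ≤ X ^ ((1 : ℝ) / 3) := by positivity
  have hcube : (X ^ ((1 : ℝ) / 3)) ^ 3 = X := by
    rw [← Real.rpow_natCast, ← Real.rpow_mul hX]
    norm_num
  generalize X ^ ((1 : ℝ) / 3) = r at *
  obtain ⟨n, h1, h2⟩ := exists_nat_pow_near (show 1 ≤ 4 * (r + 1) by linarith)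
    (show (1 : ℝ) < 3 by norm_num)
  refine ⟨n + 1, ?_, by rw [pow_succ]; linarith⟩
  calc 54 * X = 54 * r ^ 3 := by rw [hcube]
    _ ≤ (4 * r) ^ 3 := by nlinarith [pow_nonneg hr 3]
    _ < (3 ^ (n + 1)) ^ 3 := pow_lt_pow_left₀ (by linarith) (by positivity) (by norm_num)

end DiagonalConic

open DiagonalConic

theorem primitive_solutions_diagonal_conic_upper :
    ∃ C : ℝ, 0 < C ∧
      ∀ x1 x2 x3 : ℤ, x1 ≠ 0 → x2 ≠ 0 → x3 ≠ 0 →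
        Int.gcd x1 x2 = 1 → Int.gcd x1 x3 = 1 → Int.gcd x2 x3 = 1 →
        Squarefree x1 → Squarefree x2 → Squarefree x3 →
        ∀ R1 R2 R3 : ℝ, 0 < R1 → 0 < R2 → 0 < R3 →
          (Set.ncard {y : ℤ × ℤ × ℤ |
              Int.gcd y.1 (Int.gcd y.2.1 y.2.2) = 1 ∧
              x1 * y.1 ^ 2 + x2 * y.2.1 ^ 2 = x3 * y.2.2 ^ 2 ∧
              ((|y.1| : ℤ) : ℝ) ≤ R1 ∧ ((|y.2.1| : ℤ) : ℝ) ≤ R2 ∧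
              ((|y.2.2| : ℤ) : ℝ) ≤ R3} : ℝ) ≤
            C * ((x1 * x2 * x3).natAbs.divisors.card : ℝ) *
              ((R1 * R2 * R3 / ((|x1 * x2 * x3| : ℤ) : ℝ)) ^ ((1 : ℝ) / 3) + 1) := by
  refine ⟨3888, by norm_num, ?_⟩
  intro x1 x2 x3 h1 h2 h3 h12 h13 h23 hs1 hs2 hs3 R1 R2 R3 hR1 hR2 hR3
  set S := {y : ℤ × ℤ × ℤ | Int.gcd y.1 (Int.gcd y.2.1 y.2.2) = 1 ∧
    x1 * y.1 ^ 2 + x2 * y.2.1 ^ 2 = x3 * y.2.2 ^ 2 ∧ ((|y.1| : ℤ) : ℝ) ≤ R1 ∧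
    ((|y.2.1| : ℤ) : ℝ) ≤ R2 ∧ ((|y.2.2| : ℤ) : ℝ) ≤ R3} with hS
  have hD : 0 < ((|x1 * x2 * x3| : ℤ) : ℝ) := by
    exact_mod_cast abs_pos.2 (mul_ne_zero (mul_ne_zero h1 h2) h3)
  have hX : 0 ≤ R1 * R2 * R3 / ((|x1 * x2 * x3| : ℤ) : ℝ) := by positivity
  by_cases hfin : S.Finite
  swap
  · rw [Set.Infinite.ncard hfin, Nat.cast_zero]
    have := Real.rpow_nonneg hX (1 / 3)
    positivity
  obtain ⟨k, hk, hk'⟩ := exists_three_pow hX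
  have ha : IsReduced ![x1, x2, -x3] := by
    rw [← Int.isCoprime_iff_gcd_eq_one] at h12 h13 h23
    refine ⟨?_, ?_, ?_⟩
    · intro i
      fin_cases i <;> simpa
    · intro i
      fin_cases i
      · exact hs1
      · exact hs2
      · exact (Associated.refl x3).neg_left.symm.squarefree_iff.1 hs3
    · intro i j hij
      fin_cases i <;> fin_cases j <;> first | exact absurd rfl hij | skip
      · exact h12
      · exact h13.neg_right
      · exact h12.symm
      · exact h23.neg_right
      · exact h13.symm.neg_left
      · exact h23.symm.neg_left
  let ι : ℤ × ℤ × ℤ → Fin 3 → ℤ := fun y => ![y.1, y.2.1, y.2.2]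
  have hι : Function.Injective ι := by
    rintro ⟨_, _, _⟩ ⟨_, _, _⟩ h
    have e0 := congrFun h 0
    have e1 := congrFun h 1
    have e2 := congrFun h 2
    simp_all [ι]
  have hcard := card_le_of_lt ha (R := ![R1, R2, R3]) (k := k) ?_
    (hfin.toFinset.image ι) ?_ ?_
  · rw [Finset.card_image_of_injective _ hι, ← Set.ncard_eq_toFinset_card S hfin] at hcard
    have hdisc : (![x1, x2, -x3] 0 * ![x1, x2, -x3] 1 * ![x1, x2, -x3] 2).natAbs =
        (x1 * x2 * x3).natAbs := by simp
    rw [hdisc] at hcard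
    calc (S.ncard : ℝ) ≤ 324 * 3 ^ k * ((x1 * x2 * x3).natAbs.divisors.card : ℝ) := by
          exact_mod_cast hcard
      _ ≤ 324 * (12 * ((R1 * R2 * R3 / ((|x1 * x2 * x3| : ℤ) : ℝ)) ^ ((1 : ℝ) / 3) + 1)) *
          ((x1 * x2 * x3).natAbs.divisors.card : ℝ) := by gcongr
      _ = _ := by ring
  · rw [← mul_div_assoc, div_lt_iff₀ hD] at hk
    push_cast at hk
    simp only [Matrix.cons_val]
    push_cast
    rw [mul_neg, abs_neg]
    linarith
  · intro y hy
    rw [Finset.mem_image] at hy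
    obtain ⟨y, hy, rfl⟩ := hy
    obtain ⟨hg, hQ, -⟩ := (Set.Finite.mem_toFinset hfin).1 hy
    refine ⟨?_, ?_⟩
    · simp only [ι, Matrix.cons_val]
      linarith
    · have e1 := Int.gcd_eq_gcd_ab y.1 (Int.gcd y.2.1 y.2.2)
      have e2 := Int.gcd_eq_gcd_ab y.2.1 y.2.2
      rw [hg] at e1
      generalize (Int.gcd y.2.1 y.2.2 : ℤ) = g at e1 e2
      refine ⟨Int.gcdA y.1 g, Int.gcdB y.1 g * Int.gcdA y.2.1 y.2.2,
        Int.gcdB y.1 g * Int.gcdB y.2.1 y.2.2, ?_⟩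
      simp only [ι, Matrix.cons_val]
      push_cast at e1
      linear_combination -e1 - Int.gcdB y.1 g * e2
  · intro y hy i
    rw [Finset.mem_image] at hy
    obtain ⟨y, hy, rfl⟩ := hy
    obtain ⟨-, -, b1, b2, b3⟩ := (Set.Finite.mem_toFinset hfin).1 hy
    push_cast at b1 b2 b3
    fin_cases i
    · exact b1
    · exact b2
    · exact b3
end

section
/- There exists an absolute constant B0 ≥ 1 such that for every integer r ≥ 0 and every real X ≥ 3, the number of squarefree positive integers n ≤ X with exactly r distinct prime factors satisfies #{n ≤ X : ω(n) = r, μ^2(n) = 1} ≤ B0 * (X / log X) * (log log X + B0)^r / r!. -/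
/-- The squarefree positive integers up to `N` with exactly `r` prime factors. -/
def squarefreeWithPrimeFactors (r N : ℕ) : Finset ℕ :=
  (Finset.Icc 1 N).filter (fun n => Squarefree n ∧ n.primeFactors.card = r)

/-- The sum of the reciprocals of the primes up to `N`. -/
noncomputable def primeReciprocalSum (N : ℕ) : ℝ := ∑ p ∈ Nat.primesLE N, 1 / (p : ℝ)

/-- The sum of `log p / p` over the primes `p` up to `N`. -/
noncomputable def primeLogSum (N : ℕ) : ℝ := ∑ p ∈ Nat.primesLE N, Real.log p / (p : ℝ)

lemma sum_log_primeFactors_le (n : ℕ) (hn : n ≠ 0) :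
    ∑ p ∈ n.primeFactors, Real.log p ≤ Real.log n := by
  rw [← Real.log_prod fun p hp => by
    exact_mod_cast (Nat.prime_of_mem_primeFactors hp).ne_zero]
  have h := Nat.le_of_dvd (Nat.pos_of_ne_zero hn) (Nat.prod_primeFactors_dvd n)
  apply Real.log_le_log
  · exact Finset.prod_pos fun p hp => by
      exact_mod_cast (Nat.prime_of_mem_primeFactors hp).pos
  · rw [← Nat.cast_prod]
    exact_mod_cast h

lemma sum_log_primeFactors_eq {n : ℕ} (hn : Squarefree n) :
    ∑ p ∈ n.primeFactors, Real.log p = Real.log n := by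
  rw [← Real.log_prod fun p hp => by
    exact_mod_cast (Nat.prime_of_mem_primeFactors hp).ne_zero]
  rw [← Nat.cast_prod, Nat.prod_primeFactors_of_squarefree hn]

lemma sum_primesLE_log_mul_div_le (N : ℕ) :
    ∑ p ∈ Nat.primesLE N, Real.log p * ((N / p : ℕ) : ℝ) ≤ N * Real.log N := by
  calc ∑ p ∈ Nat.primesLE N, Real.log p * ((N / p : ℕ) : ℝ)
      = ∑ p ∈ Nat.primesLE N, ∑ n ∈ Finset.Ioc 0 N, if p ∣ n then Real.log p else 0 := by
        refine Finset.sum_congr rfl fun p _ => ?_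
        rw [← Finset.sum_filter, Finset.sum_const, Nat.Ioc_filter_dvd_card_eq_div, nsmul_eq_mul,
          mul_comm]
    _ = ∑ n ∈ Finset.Ioc 0 N, ∑ p ∈ Nat.primesLE N, if p ∣ n then Real.log p else 0 :=
        Finset.sum_comm
    _ ≤ ∑ n ∈ Finset.Ioc 0 N, Real.log N := by
        refine Finset.sum_le_sum fun n hn => ?_
        rw [Finset.mem_Ioc] at hn
        rw [← Finset.sum_filter]
        have : (Nat.primesLE N).filter (fun p => p ∣ n) = n.primeFactors := by
          ext p
          simp only [Finset.mem_filter, Nat.mem_primesLE, Nat.mem_primeFactors]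
          constructor
          · rintro ⟨⟨_, hp⟩, hd⟩
            exact ⟨hp, hd, by omega⟩
          · rintro ⟨hp, hd, _⟩
            exact ⟨⟨(Nat.le_of_dvd hn.1 hd).trans hn.2, hp⟩, hd⟩
        rw [this]
        refine (sum_log_primeFactors_le n (by omega)).trans ?_
        exact Real.log_le_log (by exact_mod_cast hn.1) (by exact_mod_cast hn.2)
    _ = N * Real.log N := by simp

/-- The upper bound in Mertens' first theorem. -/
lemma primeLogSum_le (N : ℕ) (hN : 1 ≤ N) : primeLogSum N ≤ Real.log N + Real.log 4 := by
  have hN' : (0 : ℝ) < N := by exact_mod_cast hN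
  have hθ := Chebyshev.theta_le_log4_mul_x hN'.le
  rw [Chebyshev.theta_eq_sum_primesLE_log] at hθ
  have h : N * primeLogSum N ≤
      ∑ p ∈ Nat.primesLE N, Real.log p * ((N / p : ℕ) : ℝ) +
        ∑ p ∈ Nat.primesLE N, Real.log p := by
    rw [primeLogSum, Finset.mul_sum, ← Finset.sum_add_distrib]
    refine Finset.sum_le_sum fun p _ => ?_
    have h1 : (N : ℝ) / p ≤ ((N / p : ℕ) : ℝ) + 1 := by
      have := (Nat.lt_floor_add_one ((N : ℝ) / p)).le
      rwa [Nat.floor_div_eq_div] at this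
    have h2 := mul_le_mul_of_nonneg_left h1 (Real.log_natCast_nonneg p)
    calc (N : ℝ) * (Real.log p / p) = Real.log p * (N / p) := by ring
      _ ≤ _ := h2
      _ = _ := by ring
  have h3 := sum_primesLE_log_mul_div_le N
  refine le_of_mul_le_mul_left ?_ hN'
  linarith

lemma sum_primesLE_succ (f : ℕ → ℝ) (n : ℕ) :
    ∑ p ∈ Nat.primesLE (n + 1), f p =
      ∑ p ∈ Nat.primesLE n, f p + if (n + 1).Prime then f (n + 1) else 0 := by
  rw [Nat.primesLE_eq_filter_range, Nat.primesLE_eq_filter_range, Finset.sum_filter,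
    Finset.sum_range_succ, ← Finset.sum_filter]

/-- Partial summation from `primeLogSum` to `primeReciprocalSum`. -/
lemma primeReciprocalSum_le_aux (N : ℕ) (hN : 2 ≤ N) :
    primeReciprocalSum N ≤ (primeLogSum N - Real.log N - Real.log 4) / Real.log N +
      Real.log (Real.log N) + 4 := by
  induction N, hN using Nat.le_induction with
  | base =>
    have h2 : Nat.primesLE 2 = {2} := by decide
    have hl : 0 < Real.log 2 := Real.log_pos (by norm_num)
    have h4 : Real.log 4 = 2 * Real.log 2 := by
      rw [show (4 : ℝ) = 2 ^ 2 by norm_num, Real.log_pow]; norm_num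
    have hll := Real.one_sub_inv_le_log_of_pos hl
    have hinv : (Real.log 2)⁻¹ ≤ 2 := by
      rw [inv_le_comm₀ hl (by norm_num)]
      linarith [Real.log_two_gt_d9]
    have : (Real.log 2 / 2 - Real.log 2 - 2 * Real.log 2) / Real.log 2 = -5 / 2 := by
      field_simp; norm_num
    simp only [primeReciprocalSum, primeLogSum, h2, Finset.sum_singleton, Nat.cast_ofNat, h4, this]
    linarith
  | succ n hn ih =>
    have hn1 : (1 : ℝ) < n := by exact_mod_cast hn
    have hL : 0 < Real.log n := Real.log_pos hn1
    have hLL : Real.log n ≤ Real.log ((n + 1 : ℕ) : ℝ) :=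
      Real.log_le_log (by linarith) (by push_cast; linarith)
    have hL' : 0 < Real.log ((n + 1 : ℕ) : ℝ) := hL.trans_le hLL
    have hD := primeLogSum_le n (by omega)
    have hS : primeReciprocalSum (n + 1) = primeReciprocalSum n +
        (primeLogSum (n + 1) - primeLogSum n) / Real.log ((n + 1 : ℕ) : ℝ) := by
      simp only [primeReciprocalSum, primeLogSum, sum_primesLE_succ]
      split_ifs
      · field_simp
        ring
      · simp
    set L := Real.log n
    set L' := Real.log ((n + 1 : ℕ) : ℝ)
    have hlog : 1 - L / L' ≤ Real.log L' - Real.log L := by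
      have := Real.one_sub_inv_le_log_of_pos (div_pos hL' hL)
      rwa [inv_div, Real.log_div hL'.ne' hL.ne'] at this
    have hdiv : (L + Real.log 4 - primeLogSum n) / L' ≤ (L + Real.log 4 - primeLogSum n) / L :=
      div_le_div_of_nonneg_left (by linarith) hL hLL
    have e1 : (primeLogSum (n + 1) - L' - Real.log 4) / L' =
        (primeLogSum (n + 1) - primeLogSum n) / L' -
          (L + Real.log 4 - primeLogSum n) / L' - (1 - L / L') := by
      field_simp
      ring
    have e2 : (primeLogSum n - L - Real.log 4) / L = -((L + Real.log 4 - primeLogSum n) / L) := by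
      ring
    rw [e2] at ih
    rw [hS, e1]
    linarith

/-- The upper bound in Mertens' second theorem. -/
lemma primeReciprocalSum_le (N : ℕ) (hN : 2 ≤ N) :
    primeReciprocalSum N ≤ Real.log (Real.log N) + 4 := by
  have h := primeReciprocalSum_le_aux N hN
  have h1 := primeLogSum_le N (by omega)
  have : (primeLogSum N - Real.log N - Real.log 4) / Real.log N ≤ 0 :=
    div_nonpos_of_nonpos_of_nonneg (by linarith) (Real.log_natCast_nonneg N)
  linarith

lemma div_mem_squarefreeWithPrimeFactors {r N n p : ℕ}
    (hn : n ∈ squarefreeWithPrimeFactors (r + 1) N) (hp : p ∈ n.primeFactors) :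
    n / p ∈ squarefreeWithPrimeFactors r N ∧ p ∈ Nat.primesLE (N / (n / p)) := by
  have hpp := Nat.prime_of_mem_primeFactors hp
  obtain ⟨m, rfl⟩ := Nat.dvd_of_mem_primeFactors hp
  simp only [squarefreeWithPrimeFactors, Finset.mem_filter, Finset.mem_Icc] at hn ⊢
  obtain ⟨⟨h1, hN⟩, hsq, hc⟩ := hn
  have hm : 0 < m := Nat.pos_of_mul_pos_left h1
  rw [Nat.mul_div_cancel_left _ hpp.pos, Nat.mem_primesLE, Nat.le_div_iff_mul_le hm]
  have hcop := Nat.coprime_of_squarefree_mul hsq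
  refine ⟨⟨⟨hm, (Nat.le_mul_of_pos_left m hpp.pos).trans hN⟩,
    hsq.squarefree_of_dvd (Dvd.intro_left p rfl), ?_⟩, hN, hpp⟩
  rw [hcop.primeFactors_mul, Finset.card_union_of_disjoint hcop.disjoint_primeFactors,
    hpp.primeFactors, Finset.card_singleton] at hc
  omega

/-- Removing one prime factor from each `n` maps pairs `(n, p)` with `p ∣ n` injectively to
pairs `(m, p)` with `m * p ≤ N`. -/
lemma sum_primeFactors_le_sum_primesLE (f : ℕ → ℕ → ℝ) (hf : ∀ p m, 0 ≤ f p m) (r N : ℕ) :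
    ∑ n ∈ squarefreeWithPrimeFactors (r + 1) N, ∑ p ∈ n.primeFactors, f p (n / p) ≤
      ∑ m ∈ squarefreeWithPrimeFactors r N, ∑ p ∈ Nat.primesLE (N / m), f p m := by
  rw [Finset.sum_sigma', Finset.sum_sigma']
  let e : (_ : ℕ) × ℕ → (_ : ℕ) × ℕ := fun x => ⟨x.1 / x.2, x.2⟩
  let s := (squarefreeWithPrimeFactors (r + 1) N).sigma fun n => n.primeFactors
  have he : Set.InjOn e s := by
    rintro ⟨n, p⟩ hx ⟨n', p'⟩ hx' h
    simp only [s, Finset.mem_coe, Finset.mem_sigma] at hx hx'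
    simp only [e, Sigma.mk.injEq, heq_eq_eq] at h
    obtain ⟨h, rfl⟩ := h
    have h1 := Nat.div_mul_cancel (Nat.dvd_of_mem_primeFactors hx.2)
    have h2 := Nat.div_mul_cancel (Nat.dvd_of_mem_primeFactors hx'.2)
    rw [h, h2] at h1
    rw [h1]
  refine (Finset.sum_image (s := s) (f := fun y => f y.2 y.1) he).symm.trans_le ?_
  refine Finset.sum_le_sum_of_subset_of_nonneg ?_ fun _ _ _ => hf _ _
  intro y hy
  obtain ⟨x, hx, rfl⟩ := Finset.mem_image.mp hy
  simp only [s, Finset.mem_sigma] at hx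
  exact Finset.mem_sigma.mpr (div_mem_squarefreeWithPrimeFactors hx.1 hx.2)

lemma primeReciprocalSum_mono : Monotone primeReciprocalSum := fun _ _ h =>
  Finset.sum_le_sum_of_subset_of_nonneg (Nat.primesLE_mono h) fun _ _ _ => by positivity

lemma primeReciprocalSum_nonneg (N : ℕ) : 0 ≤ primeReciprocalSum N :=
  Finset.sum_nonneg fun _ _ => by positivity

lemma eq_one_of_mem_squarefreeWithPrimeFactors_zero {n N : ℕ}
    (hn : n ∈ squarefreeWithPrimeFactors 0 N) : n = 1 := by
  simp only [squarefreeWithPrimeFactors, Finset.mem_filter, Finset.mem_Icc,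
    Finset.card_eq_zero, Nat.primeFactors_eq_empty] at hn
  omega

lemma sum_one_div_le (r N : ℕ) :
    ∑ n ∈ squarefreeWithPrimeFactors r N, 1 / (n : ℝ) ≤
      primeReciprocalSum N ^ r / (r.factorial : ℝ) := by
  induction r with
  | zero =>
    have h : squarefreeWithPrimeFactors 0 N ⊆ {1} := fun n hn =>
      Finset.mem_singleton.mpr (eq_one_of_mem_squarefreeWithPrimeFactors_zero hn)
    refine (Finset.sum_le_sum_of_subset_of_nonneg h fun _ _ _ => by positivity).trans ?_
    simp
  | succ r ih =>
    have h := sum_primeFactors_le_sum_primesLE (fun p m => 1 / (p : ℝ) * (1 / (m : ℝ)))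
      (fun _ _ => by positivity) r N
    have hl : ∑ n ∈ squarefreeWithPrimeFactors (r + 1) N, ∑ p ∈ n.primeFactors,
        1 / (p : ℝ) * (1 / ((n / p : ℕ) : ℝ)) =
        (r + 1) * ∑ n ∈ squarefreeWithPrimeFactors (r + 1) N, 1 / (n : ℝ) := by
      rw [Finset.mul_sum]
      refine Finset.sum_congr rfl fun n hn => ?_
      have hc : n.primeFactors.card = r + 1 := (Finset.mem_filter.mp hn).2.2
      calc _ = ∑ p ∈ n.primeFactors, 1 / (n : ℝ) := by
            refine Finset.sum_congr rfl fun p hp => ?_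
            have := Nat.mul_div_cancel' (Nat.dvd_of_mem_primeFactors hp)
            rw [div_mul_div_comm, one_mul, ← Nat.cast_mul, this]
        _ = _ := by simp [hc]
    have hr : ∑ m ∈ squarefreeWithPrimeFactors r N, ∑ p ∈ Nat.primesLE (N / m),
        1 / (p : ℝ) * (1 / (m : ℝ)) ≤
        primeReciprocalSum N * ∑ m ∈ squarefreeWithPrimeFactors r N, 1 / (m : ℝ) := by
      rw [Finset.mul_sum]
      refine Finset.sum_le_sum fun m _ => ?_
      rw [← Finset.sum_mul]
      exact mul_le_mul_of_nonneg_right (primeReciprocalSum_mono (Nat.div_le_self N m))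
        (by positivity)
    have h1 := mul_le_mul_of_nonneg_left ih (primeReciprocalSum_nonneg N)
    rw [hl] at h
    rw [Nat.factorial_succ, le_div_iff₀ (by positivity)]
    have hfac : (0 : ℝ) < r.factorial := by positivity
    calc _ = (r.factorial : ℝ) * ((r + 1) *
          ∑ n ∈ squarefreeWithPrimeFactors (r + 1) N, 1 / (n : ℝ)) := by push_cast; ring
      _ ≤ (r.factorial : ℝ) * (primeReciprocalSum N *
          (primeReciprocalSum N ^ r / (r.factorial : ℝ))) :=
        mul_le_mul_of_nonneg_left (by linarith) hfac.le
      _ = _ := by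
        field_simp
        ring

lemma sum_log_le (r N : ℕ) :
    ∑ n ∈ squarefreeWithPrimeFactors (r + 1) N, Real.log n ≤
      Real.log 4 * N * (primeReciprocalSum N ^ r / (r.factorial : ℝ)) := by
  calc _ = ∑ n ∈ squarefreeWithPrimeFactors (r + 1) N, ∑ p ∈ n.primeFactors, Real.log p :=
        Finset.sum_congr rfl fun n hn =>
          (sum_log_primeFactors_eq (Finset.mem_filter.mp hn).2.1).symm
    _ ≤ _ := sum_primeFactors_le_sum_primesLE (fun p _ => Real.log p)
        (fun p _ => Real.log_natCast_nonneg p) r N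
    _ ≤ ∑ m ∈ squarefreeWithPrimeFactors r N, Real.log 4 * N * (1 / (m : ℝ)) := by
        refine Finset.sum_le_sum fun m _ => ?_
        rw [← Chebyshev.theta_eq_sum_primesLE_log]
        refine (Chebyshev.theta_le_log4_mul_x (Nat.cast_nonneg _)).trans ?_
        rw [mul_assoc, mul_one_div]
        exact mul_le_mul_of_nonneg_left Nat.cast_div_le (Real.log_nonneg (by norm_num))
    _ ≤ _ := by
        rw [← Finset.mul_sum]
        exact mul_le_mul_of_nonneg_left (sum_one_div_le r N)
          (mul_nonneg (Real.log_nonneg (by norm_num)) (Nat.cast_nonneg _))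

lemma pow_succ_add_le_add_one_pow {s : ℝ} (hs : 0 ≤ s) (k : ℕ) :
    s ^ (k + 1) + (k + 1) * s ^ k ≤ (s + 1) ^ (k + 1) := by
  induction k with
  | zero => simp
  | succ k ih =>
    have h := mul_le_mul_of_nonneg_right ih (by linarith : (0 : ℝ) ≤ s + 1)
    have h1 : 0 ≤ ((k : ℝ) + 1) * s ^ k := by positivity
    rw [pow_succ (s + 1) (k + 1)]
    push_cast
    linarith [pow_succ s (k + 1), pow_succ s k,
      (by ring : (s ^ (k + 1) + (k + 1) * s ^ k) * (s + 1) =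
        s ^ (k + 1 + 1) + (k + 1 + 1) * s ^ (k + 1) + (k + 1) * s ^ k)]

lemma card_mul_log_le (r : ℕ) {X : ℝ} (hX : 1 ≤ X) :
    ((squarefreeWithPrimeFactors r ⌊X⌋₊).card : ℝ) * Real.log X ≤
      2 * X * ((primeReciprocalSum ⌊X⌋₊ + 1) ^ r / (r.factorial : ℝ)) := by
  set N := ⌊X⌋₊
  set S := primeReciprocalSum N
  have hX0 : 0 < X := by linarith
  have hS : 0 ≤ S := primeReciprocalSum_nonneg N
  have hNX : (N : ℝ) ≤ X := Nat.floor_le hX0.le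
  have hlog4 : Real.log 4 ≤ 2 := by
    rw [show (4 : ℝ) = 2 ^ 2 by norm_num, Real.log_pow]
    push_cast
    linarith [Real.log_two_lt_d9]
  have hlog4' : 0 ≤ Real.log 4 := Real.log_nonneg (by norm_num)
  have hmain : ((squarefreeWithPrimeFactors r N).card : ℝ) * Real.log X ≤
      ∑ n ∈ squarefreeWithPrimeFactors r N, Real.log n + X * (S ^ r / (r.factorial : ℝ)) := by
    refine le_trans ?_ (add_le_add_right
      (mul_le_mul_of_nonneg_left (sum_one_div_le r N) hX0.le) _)
    rw [Finset.mul_sum, ← Finset.sum_add_distrib, ← nsmul_eq_mul, ← Finset.sum_const]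
    refine Finset.sum_le_sum fun n hn => ?_
    have hn0 : (0 : ℝ) < n := by
      exact_mod_cast (Finset.mem_Icc.mp (Finset.mem_filter.mp hn).1).1
    have := Real.log_le_sub_one_of_pos (div_pos hX0 hn0)
    rw [Real.log_div hX0.ne' hn0.ne'] at this
    rw [mul_one_div]
    linarith
  cases r with
  | zero =>
    have : ∑ n ∈ squarefreeWithPrimeFactors 0 N, Real.log n = 0 :=
      Finset.sum_eq_zero fun n hn => by
        simp [eq_one_of_mem_squarefreeWithPrimeFactors_zero hn]
    rw [this] at hmain
    simp only [pow_zero, Nat.factorial_zero, Nat.cast_one, div_one, mul_one, zero_add] at hmain ⊢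
    linarith
  | succ k =>
    have h1 := sum_log_le k N
    have h2 : Real.log 4 * N * (S ^ k / (k.factorial : ℝ)) ≤
        2 * X * (S ^ k / (k.factorial : ℝ)) := by gcongr
    have h3 : X * (S ^ (k + 1) / ((k + 1).factorial : ℝ)) ≤
        2 * X * (S ^ (k + 1) / ((k + 1).factorial : ℝ)) := by
      apply mul_le_mul_of_nonneg_right (by linarith) (by positivity)
    have h4 : S ^ k / (k.factorial : ℝ) + S ^ (k + 1) / ((k + 1).factorial : ℝ) ≤
        (S + 1) ^ (k + 1) / ((k + 1).factorial : ℝ) := by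
      have e : S ^ k / (k.factorial : ℝ) = (k + 1) * S ^ k / ((k + 1).factorial : ℝ) := by
        rw [Nat.factorial_succ]
        push_cast
        field_simp
      rw [e, ← add_div]
      apply div_le_div_of_nonneg_right _ (by positivity)
      linarith [pow_succ_add_le_add_one_pow hS k]
    have h5 := mul_le_mul_of_nonneg_left h4 (by linarith : 0 ≤ 2 * X)
    linarith

open Real

theorem squarefree_with_r_prime_factors_count :
    ∃ B0 : ℝ, 1 ≤ B0 ∧
      ∀ (r : ℕ) (X : ℝ), 3 ≤ X →
        (((Finset.Icc 1 ⌊X⌋₊).filter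
            (fun n => Squarefree n ∧ n.primeFactors.card = r)).card : ℝ) ≤
          B0 * (X / Real.log X) * (Real.log (Real.log X) + B0) ^ r / (Nat.factorial r : ℝ) := by
  refine ⟨5, by norm_num, fun r X hX => ?_⟩
  have hX0 : 0 < X := by linarith
  have hL : 0 < Real.log X := Real.log_pos (by linarith)
  have hN : 2 ≤ ⌊X⌋₊ := Nat.le_floor (by push_cast; linarith)
  have hN1 : (1 : ℝ) < (⌊X⌋₊ : ℝ) := by exact_mod_cast hN
  have hS := primeReciprocalSum_le _ hN
  have hS0 := primeReciprocalSum_nonneg ⌊X⌋₊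
  have hll : Real.log (Real.log (⌊X⌋₊ : ℝ)) ≤ Real.log (Real.log X) :=
    Real.log_le_log (Real.log_pos hN1)
      (Real.log_le_log (by linarith) (Nat.floor_le hX0.le))
  have h := card_mul_log_le r (by linarith : 1 ≤ X)
  rw [← le_div_iff₀ hL] at h
  refine h.trans ?_
  calc _ = 2 * (X / Real.log X) * (primeReciprocalSum ⌊X⌋₊ + 1) ^ r / (r.factorial : ℝ) := by
        ring
    _ ≤ _ := by
        have : primeReciprocalSum ⌊X⌋₊ + 1 ≤ Real.log (Real.log X) + 5 := by linarith
        gcongr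
        norm_num
end
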